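/- arXiv:2508.07113 — 2 statements merged into one kernel-verified Lean document; each statement's English description precedes it below -/
import Mathlib

section
/- Let p be a prime, n ≥ 1, q = p^n, k a divisor of n, and let U be an 𝔽_{p^k}-subspace of 𝔽_q with 1 ∈ U and #U > 2. Let d be the smallest positive integer such that u^{p^{dk}} = u for all u ∈ U, and set A(x) = ∏_{u ∈ U}(x − u) ∈ 𝔽_q[x]. Then: (1) dk divides n, so 𝔽_{p^{dk}} = {c ∈ 𝔽_q : c^{p^{dk}} = c} is a subfield of 𝔽_q; (2) there exists a monic p^k-linearized polynomial M ∈ 𝔽_q[x] such that A(M(x)) = M(A(x)) = x^{p^{dk}} − x; and (3) for such M one has 𝒫(U, q) = {M(f(x)) : f ∈ 𝒫(𝔽_{p^{dk}}, q)}. -/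
open Polynomial

/-- The value set of a polynomial over a finite field. -/
def valueSet {F : Type*} [Field F] [Fintype F] [DecidableEq F] (f : F[X]) : Finset F :=
  Finset.image (fun a => f.eval a) Finset.univ

/-- A minimal value set polynomial (MVSP): a nonconstant polynomial whose value set has
the minimal possible size `⌊(q-1)/deg f⌋ + 1`. -/
def IsMVSP {F : Type*} [Field F] [Fintype F] [DecidableEq F] (f : F[X]) : Prop :=
  0 < f.natDegree ∧ (valueSet f).card = (Fintype.card F - 1) / f.natDegree + 1

/-- `MVSPset S` is the set `𝒫(S, q)` of all MVSPs with value set `S`. -/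
def MVSPset {F : Type*} [Field F] [Fintype F] [DecidableEq F] (S : Finset F) : Set F[X] :=
  {f | IsMVSP f ∧ valueSet f = S}

/-- `U` is a subspace over the subfield `{c : c ^ r = c}` (with `r = p ^ k`):
an additive subgroup closed under multiplication by elements of that subfield. -/
def IsSubspaceOver {F : Type*} [Field F] (r : ℕ) (U : Set F) : Prop :=
  (0 : F) ∈ U ∧ (∀ x ∈ U, ∀ y ∈ U, x + y ∈ U) ∧ (∀ x ∈ U, -x ∈ U) ∧
    (∀ c : F, c ^ r = c → ∀ x ∈ U, c * x ∈ U)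

/-- An `r`-linearized polynomial (with `r = q` or `r = p ^ k`): of the form `Σ aᵢ x ^ (r ^ i)`. -/
def IsLinearized {F : Type*} [Field F] (r : ℕ) (M : F[X]) : Prop :=
  ∃ (s : ℕ) (a : ℕ → F), M = ∑ i ∈ Finset.range (s + 1), C (a i) * X ^ r ^ i


def FrobOK (F : Type) [Field F] (r : ℕ) : Prop :=
  ∃ p k : ℕ, p.Prime ∧ CharP F p ∧ 0 < k ∧ r = p ^ k

section basics
variable {F : Type} [Field F] {r : ℕ}

lemma FrobOK.one_lt (h : FrobOK F r) : 1 < r := by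
  obtain ⟨p, k, hp, _, hk, rfl⟩ := h
  exact Nat.one_lt_pow hk.ne' hp.one_lt

lemma FrobOK.ne (h : FrobOK F r) (t : ℕ) : r ^ t ≠ 0 := by
  have := h.one_lt
  positivity

lemma FrobOK.add (h : FrobOK F r) (t : ℕ) (x y : F) :
    (x + y) ^ r ^ t = x ^ r ^ t + y ^ r ^ t := by
  obtain ⟨p, k, hp, _, hk, rfl⟩ := h
  have := Fact.mk hp
  rw [← pow_mul, add_pow_char_pow]

lemma FrobOK.sub (h : FrobOK F r) (t : ℕ) (x y : F) :
    (x - y) ^ r ^ t = x ^ r ^ t - y ^ r ^ t := by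
  obtain ⟨p, k, hp, _, hk, rfl⟩ := h
  have := Fact.mk hp
  rw [← pow_mul, sub_pow_char_pow]

lemma FrobOK.addX (h : FrobOK F r) (t : ℕ) (x y : F[X]) :
    (x + y) ^ r ^ t = x ^ r ^ t + y ^ r ^ t := by
  obtain ⟨p, k, hp, _, hk, rfl⟩ := h
  have := Fact.mk hp
  rw [← pow_mul, add_pow_char_pow]

lemma FrobOK.subX (h : FrobOK F r) (t : ℕ) (x y : F[X]) :
    (x - y) ^ r ^ t = x ^ r ^ t - y ^ r ^ t := by
  obtain ⟨p, k, hp, _, hk, rfl⟩ := h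
  have := Fact.mk hp
  rw [← pow_mul, sub_pow_char_pow]

lemma FrobOK.sum (h : FrobOK F r) (t : ℕ) {ι : Type*} (s : Finset ι) (f : ι → F) :
    (∑ i ∈ s, f i) ^ r ^ t = ∑ i ∈ s, f i ^ r ^ t := by
  obtain ⟨p, k, hp, _, hk, rfl⟩ := h
  have := Fact.mk hp
  rw [← pow_mul, sum_pow_char_pow]

lemma FrobOK.sumX (h : FrobOK F r) (t : ℕ) {ι : Type*} (s : Finset ι) (f : ι → F[X]) :
    (∑ i ∈ s, f i) ^ r ^ t = ∑ i ∈ s, f i ^ r ^ t := by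
  obtain ⟨p, k, hp, _, hk, rfl⟩ := h
  have := Fact.mk hp
  rw [← pow_mul, sum_pow_char_pow]

lemma FrobOK.neg (h : FrobOK F r) (t : ℕ) (x : F) : (-x) ^ r ^ t = - x ^ r ^ t := by
  have := h.sub t 0 x
  rwa [zero_sub, zero_pow (h.ne t), zero_sub] at this

lemma lin_add (h : FrobOK F r) {L : F[X]} (hL : IsLinearized r L) (P Q : F[X]) :
    L.comp (P + Q) = L.comp P + L.comp Q := by
  obtain ⟨s, a, rfl⟩ := hL
  simp only [sum_comp, mul_comp, C_comp, X_pow_comp, h.addX, mul_add, Finset.sum_add_distrib]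

lemma lin_eval_add (h : FrobOK F r) {L : F[X]} (hL : IsLinearized r L) (x y : F) :
    L.eval (x + y) = L.eval x + L.eval y := by
  obtain ⟨s, a, rfl⟩ := hL
  simp only [eval_finsetSum, eval_mul, eval_C, eval_pow, eval_X, h.add, mul_add,
    Finset.sum_add_distrib]

lemma lin_eval_zero (h : FrobOK F r) {L : F[X]} (hL : IsLinearized r L) : L.eval 0 = 0 := by
  have := lin_eval_add h hL 0 0
  simpa using this

lemma pow_iter_fix {c : F} (hc : c ^ r = c) (i : ℕ) : c ^ r ^ i = c := by
  induction i with
  | zero => simp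
  | succ i ih => rw [pow_succ, pow_mul, ih, hc]

lemma lin_eval_smul {L : F[X]} (hL : IsLinearized r L) {c : F}
    (hc : c ^ r = c) (x : F) : L.eval (c * x) = c * L.eval x := by
  obtain ⟨s, a, rfl⟩ := hL
  simp only [eval_finsetSum, eval_mul, eval_C, eval_pow, eval_X, Finset.mul_sum, mul_pow,
    pow_iter_fix hc]
  exact Finset.sum_congr rfl fun i _ => by ring

lemma lin_coeff_ne {L : F[X]} (hL : IsLinearized r L) {j : ℕ} (hj : L.coeff j ≠ 0) : ∃ i, j = r ^ i := by
  obtain ⟨s, a, rfl⟩ := hL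
  by_contra! hne
  apply hj
  rw [finsetSum_coeff]
  refine Finset.sum_eq_zero fun i _ => ?_
  rw [coeff_C_mul, coeff_X_pow, if_neg (hne i), mul_zero]

lemma sum_coeff (hr : 1 < r) (a : ℕ → F) (T t : ℕ) (ht : t < T) :
    (∑ i ∈ Finset.range T, C (a i) * X ^ r ^ i).coeff (r ^ t) = a t := by
  rw [finsetSum_coeff, Finset.sum_eq_single t]
  · simp
  · intro b _ hb
    rw [coeff_C_mul, coeff_X_pow, if_neg, mul_zero]
    intro h
    exact hb (Nat.pow_right_injective hr h).symm
  · simp [ht]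

lemma lin_repr (hr : 1 < r) {L : F[X]} (hL : IsLinearized r L) (T : ℕ) (hT : L.natDegree < r ^ T) :
    L = ∑ i ∈ Finset.range T, C (L.coeff (r ^ i)) * X ^ r ^ i := by
  ext j
  by_cases hj : L.coeff j = 0
  · rw [hj, finsetSum_coeff]
    symm
    refine Finset.sum_eq_zero fun i _ => ?_
    rw [coeff_C_mul, coeff_X_pow]
    split_ifs with h
    · rw [← h, hj]; simp
    · simp
  · obtain ⟨i, rfl⟩ := lin_coeff_ne hL hj
    rw [sum_coeff hr (fun i => L.coeff (r ^ i))]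
    have := le_natDegree_of_ne_zero hj
    exact (Nat.pow_lt_pow_iff_right hr).1 (this.trans_lt hT)

lemma lin_natDegree {L : F[X]} (hL : IsLinearized r L) (hm : L.Monic) :
    ∃ m, L.natDegree = r ^ m :=
  lin_coeff_ne hL (j := L.natDegree) (by
    have : L.coeff L.natDegree = 1 := hm
    rw [this]; exact one_ne_zero)

/-- coefficients of a composition -/
lemma comp_coeff (h : FrobOK F r) {L M : F[X]} (hL : IsLinearized r L) (hM : IsLinearized r M)
    (t : ℕ) : (L.comp M).coeff (r ^ t) =
      ∑ i ∈ Finset.range (t + 1), L.coeff (r ^ i) * (M.coeff (r ^ (t - i))) ^ r ^ i := by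
  have hr := h.one_lt
  obtain ⟨T, hT1, hT2, hT3⟩ : ∃ T, L.natDegree < r ^ T ∧ M.natDegree < r ^ T ∧ t < T := by
    refine ⟨L.natDegree + M.natDegree + t + 1, ?_, ?_, by omega⟩
    · exact lt_trans (by omega) (Nat.lt_pow_self hr)
    · exact lt_trans (by omega) (Nat.lt_pow_self hr)
  have e : L.comp M = ∑ i ∈ Finset.range T, ∑ s ∈ Finset.range T,
      C (L.coeff (r ^ i) * (M.coeff (r ^ s)) ^ r ^ i) * X ^ r ^ (i + s) := by
    conv_lhs => rw [lin_repr hr hL T hT1, lin_repr hr hM T hT2]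
    simp only [sum_comp, mul_comp, C_comp, X_pow_comp, h.sumX, Finset.mul_sum]
    refine Finset.sum_congr rfl fun i _ => Finset.sum_congr rfl fun s _ => ?_
    rw [mul_pow, ← pow_mul, ← pow_add, add_comm s i, C_mul, C_pow, mul_assoc]
  rw [e]
  simp only [finsetSum_coeff, coeff_C_mul, coeff_X_pow, (Nat.pow_right_injective hr).eq_iff]
  rw [← Finset.sum_subset (Finset.range_mono (show t + 1 ≤ T by omega))]
  · refine Finset.sum_congr rfl fun i hi => ?_
    have hi' : i < t + 1 := Finset.mem_range.1 hi
    rw [Finset.sum_eq_single (t - i)]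
    · rw [if_pos (by omega), mul_one]
    · intro b _ hb
      rw [if_neg (by omega), mul_zero]
    · intro hb; simp at hb; omega
  · intro i _ hi
    simp at hi
    refine Finset.sum_eq_zero fun s _ => ?_
    rw [if_neg (by omega), mul_zero]

end basics

lemma linP {F : Type} [Field F] {r : ℕ} (h : FrobOK F r) (ε a μ : ℕ → F) (m d b : ℕ)
    (hrec : ∀ s, ∑ i ∈ Finset.range (m + 1), a i ^ r ^ s * ε (s + i) = 0)
    (hper : ∀ t, ε (t + d) = ε t) (ha : ∀ i, m < i → a i = 0)
    (hconv : ∀ t, 0 < t → t < d → ∑ i ∈ Finset.range (t + 1), a i * μ (t - i) ^ r ^ i = 0)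
    (ha0 : a 0 ≠ 0) (hμ0 : μ 0 ≠ 0) (hz : ∀ i, 1 ≤ i → i < m → ε (b + i) = 0) :
    ∀ l, l < d → ε (b + d - l) = ε b / μ 0 ^ r ^ (b + d) * μ l ^ r ^ (b + d - l) := by
  intro l
  induction l using Nat.strong_induction_on with
  | _ l ih =>
  intro hl
  rcases Nat.eq_zero_or_pos l with rfl | hl0
  · rw [Nat.sub_zero, hper, div_mul_cancel₀ _ (pow_ne_zero _ hμ0)]
  set κ := ε b / μ 0 ^ r ^ (b + d) with hκ
  set s := b + d - l with hs
  have h1 := hrec s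
  have h2 : ∑ i ∈ Finset.range (m + 1), a i ^ r ^ s * ε (s + i)
      = ∑ i ∈ Finset.range (m + l + 1), a i ^ r ^ s * ε (s + i) := by
    refine Finset.sum_subset (Finset.range_mono (by omega)) fun i _ hi => ?_
    simp at hi
    rw [ha i (by omega), zero_pow (h.ne s), zero_mul]
  have h3 : ∑ i ∈ Finset.range (l + 1), a i ^ r ^ s * ε (s + i)
      = ∑ i ∈ Finset.range (m + l + 1), a i ^ r ^ s * ε (s + i) := by
    refine Finset.sum_subset (Finset.range_mono (by omega)) fun i _ hi => ?_
    simp at hi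
    by_cases him : m < i
    · rw [ha i him, zero_pow (h.ne s), zero_mul]
    · rw [show s + i = b + (i - l) + d by omega, hper, hz _ (by omega) (by omega), mul_zero]
  rw [h2, ← h3, Finset.sum_range_succ'] at h1
  have h4 := hconv l hl0 hl
  have h5 : κ * (∑ i ∈ Finset.range (l + 1), a i * μ (l - i) ^ r ^ i) ^ r ^ s = 0 := by
    rw [h4, zero_pow (h.ne s), mul_zero]
  rw [h.sum, Finset.mul_sum, Finset.sum_range_succ'] at h5
  have h6 : ∑ k ∈ Finset.range l, a (k + 1) ^ r ^ s * ε (s + (k + 1)) =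
      ∑ k ∈ Finset.range l, κ * (a (k + 1) * μ (l - (k + 1)) ^ r ^ (k + 1)) ^ r ^ s := by
    refine Finset.sum_congr rfl fun i hi => ?_
    have := Finset.mem_range.1 hi
    rw [show s + (i + 1) = b + d - (l - (i + 1)) by omega, ih _ (by omega) (by omega), mul_pow,
      ← pow_mul, ← pow_add, show i + 1 + s = b + d - (l - (i + 1)) by omega]
    ring
  rw [h6] at h1
  have h7 := h1.trans h5.symm
  have h8 := add_left_cancel h7
  simp only [add_zero, Nat.sub_zero, pow_zero, pow_one, mul_pow] at h8
  apply mul_left_cancel₀ (pow_ne_zero (r ^ s) ha0)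
  rw [h8]; ring

section subspaces
variable {F : Type} [Field F] {r : ℕ}

lemma lin_of_coeff (hr : 1 < r) {L : F[X]} (hL : ∀ j, L.coeff j ≠ 0 → ∃ i, j = r ^ i) :
    IsLinearized r L := by
  refine ⟨L.natDegree, fun i => L.coeff (r ^ i), ?_⟩
  ext j
  by_cases hj : L.coeff j = 0
  · rw [hj, finsetSum_coeff]
    symm
    refine Finset.sum_eq_zero fun i _ => ?_
    rw [coeff_C_mul, coeff_X_pow]
    split_ifs with h
    · simp only [← h, hj, zero_mul]
    · simp
  · obtain ⟨i, rfl⟩ := hL j hj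
    rw [sum_coeff hr (fun i => L.coeff (r ^ i))]
    have := le_natDegree_of_ne_zero hj
    have h2 : i < r ^ i := Nat.lt_pow_self hr
    omega

lemma lin_sub (hr : 1 < r) {L M : F[X]} (hL : IsLinearized r L) (hM : IsLinearized r M) :
    IsLinearized r (L - M) := by
  refine lin_of_coeff hr fun j hj => ?_
  by_cases h : L.coeff j = 0
  · refine lin_coeff_ne hM fun h' => hj ?_
    rw [coeff_sub, h, h', sub_zero]
  · exact lin_coeff_ne hL h

lemma lin_C_mul (hr : 1 < r) {L : F[X]} (hL : IsLinearized r L) (c : F) :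
    IsLinearized r (C c * L) := by
  refine lin_of_coeff hr fun j hj => lin_coeff_ne hL fun h' => hj ?_
  rw [coeff_C_mul, h', mul_zero]

lemma lin_pow (h : FrobOK F r) {L : F[X]} (hL : IsLinearized r L) : IsLinearized r (L ^ r) := by
  obtain ⟨s, a, rfl⟩ := hL
  refine ⟨s + 1, fun i => if i = 0 then 0 else a (i - 1) ^ r, ?_⟩
  have := h.sumX 1 (Finset.range (s + 1)) (fun i => C (a i) * X ^ r ^ i)
  rw [pow_one] at this
  rw [this, Finset.sum_range_succ' _ (s + 1)]
  simp [mul_pow, ← pow_mul, ← pow_succ]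

lemma eq_prod_of_roots {L : F[X]} (hL : L.Monic) (S : Finset F)
    (hd : L.natDegree = S.card) (hS : ∀ x ∈ S, L.eval x = 0) : L = ∏ x ∈ S, (X - C x) := by
  have hm : (∏ x ∈ S, (X - C x)).Monic := monic_prod_of_monic _ _ fun x _ => monic_X_sub_C x
  have hdeg : (∏ x ∈ S, (X - C x)).natDegree = S.card := by
    rw [natDegree_prod_of_monic _ _ fun x _ => monic_X_sub_C x]; simp
  have hdvd : (∏ x ∈ S, (X - C x)) ∣ L := by
    refine Finset.prod_dvd_of_coprime ?_ ?_
    · intro x _ y _ hxy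
      exact isCoprime_X_sub_C_of_isUnit_sub (sub_ne_zero.2 hxy).isUnit
    · intro x hx
      exact dvd_iff_isRoot.2 (hS x hx)
  exact (eq_of_monic_of_dvd_of_natDegree_le hm hL hdvd (by rw [hd, hdeg]))

lemma natDegree_prodU (S : Finset F) : (∏ x ∈ S, (X - C x)).natDegree = S.card := by
  rw [natDegree_prod_of_monic _ _ fun x _ => monic_X_sub_C x]; simp

lemma monic_prodU (S : Finset F) : (∏ x ∈ S, (X - C x)).Monic :=
  monic_prod_of_monic _ _ fun x _ => monic_X_sub_C x

lemma eval_prodU (S : Finset F) (x : F) : (∏ u ∈ S, (X - C u)).eval x = 0 ↔ x ∈ S := by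
  rw [eval_prod, Finset.prod_eq_zero_iff]
  constructor
  · rintro ⟨u, hu, h⟩
    simp only [eval_sub, eval_X, eval_C, sub_eq_zero] at h
    rwa [h]
  · intro h
    exact ⟨x, h, by simp⟩

variable [Fintype F] [DecidableEq F]

lemma card_fix (hr : 1 < r) {N d : ℕ} (hcard : Fintype.card F = r ^ N) (hN : 0 < N)
    (hd : d ∣ N) : (Finset.univ.filter (fun c : F => c ^ r ^ d = c)).card = r ^ d := by
  have hd0 : d ≠ 0 := by rintro rfl; simp at hd; omega
  have hdvd : (X ^ r ^ d - X : F[X]) ∣ X ^ r ^ N - X := dvd_pow_pow_sub_self_of_dvd hd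
  obtain ⟨R, hR⟩ := hdvd
  have h0 : (X ^ r ^ N - X : F[X]) ≠ 0 :=
    FiniteField.X_pow_card_pow_sub_X_ne_zero F hN.ne' hr
  have hroots : (X ^ r ^ N - X : F[X]).roots = Finset.univ.val := by
    rw [← hcard]; exact FiniteField.roots_X_pow_card_sub_X F
  have hdeg : (X ^ r ^ N - X : F[X]).natDegree = r ^ N :=
    FiniteField.X_pow_card_pow_sub_X_natDegree_eq F hN.ne' hr
  have hdeg' : (X ^ r ^ d - X : F[X]).natDegree = r ^ d :=
    FiniteField.X_pow_card_pow_sub_X_natDegree_eq F hd0 hr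
  rw [hR] at h0 hroots hdeg
  have hP0 := left_ne_zero_of_mul h0
  have hR0 := right_ne_zero_of_mul h0
  rw [natDegree_mul hP0 hR0] at hdeg
  rw [roots_mul h0] at hroots
  have hc := congrArg Multiset.card hroots
  rw [Multiset.card_add] at hc
  have : Multiset.card (Finset.univ : Finset F).val = r ^ N := hcard
  have h1 := card_roots' (X ^ r ^ d - X : F[X])
  have h2 := card_roots' R
  have h3 : Multiset.card (X ^ r ^ d - X : F[X]).roots = r ^ d := by omega
  have hnd : (X ^ r ^ d - X : F[X]).roots.Nodup :=
    Multiset.nodup_of_le (hroots ▸ Multiset.le_add_right _ _) Finset.univ.nodup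
  refine Eq.trans ?_ ((Multiset.toFinset_card_of_nodup hnd).trans h3)
  congr 1
  ext x
  simp [mem_roots hP0, sub_eq_zero]

lemma lin_prod (h : FrobOK F r) {N : ℕ} (hcard : Fintype.card F = r ^ N) (hN : 0 < N)
    (U : Finset F) (hU : IsSubspaceOver r (↑U : Set F)) :
    IsLinearized r (∏ u ∈ U, (X - C u)) := by
  have hr := h.one_lt
  have key : ∀ S : Finset F, S ⊆ U → ∃ V : Finset F, V ⊆ U ∧ S ⊆ V ∧
      IsSubspaceOver r (↑V : Set F) ∧ IsLinearized r (∏ u ∈ V, (X - C u)) := by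
    intro S
    induction S using Finset.induction_on with
    | empty =>
      intro _
      refine ⟨{0}, by simpa using hU.1, by simp, ?_, 0, fun _ => 1, by simp⟩
      refine ⟨by simp, by simp, by simp, by simp⟩
    | insert v S hv ih =>
      intro hS
      obtain ⟨V, hVU, hSV, hV, hlin⟩ := ih (fun x hx => hS (Finset.mem_insert_of_mem hx))
      have hvU : v ∈ U := hS (Finset.mem_insert_self _ _)
      by_cases hvV : v ∈ V
      · exact ⟨V, hVU, Finset.insert_subset hvV hSV, hV, hlin⟩
      obtain ⟨V0, Vadd, Vneg, Vsm⟩ := hV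
      obtain ⟨U0, Uadd, Uneg, Usm⟩ := hU
      set K := Finset.univ.filter (fun c : F => c ^ r ^ 1 = c) with hK
      have hKcard : K.card = r ^ 1 := card_fix hr hcard hN (one_dvd _)
      have memK : ∀ c, c ∈ K ↔ c ^ r = c := by simp [hK]
      set V' := (V ×ˢ K).image (fun z => z.1 + z.2 * v) with hV'
      have memV' : ∀ x, x ∈ V' ↔ ∃ y ∈ V, ∃ c, c ^ r = c ∧ y + c * v = x := by
        intro x
        simp only [hV', Finset.mem_image, Finset.mem_product, memK, Prod.exists]
        constructor
        · rintro ⟨y, c, ⟨hy, hc⟩, e⟩; exact ⟨y, hy, c, hc, e⟩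
        · rintro ⟨y, hy, c, hc, e⟩; exact ⟨y, c, ⟨hy, hc⟩, e⟩
      have fr1 : ∀ x y : F, (x + y) ^ r = x ^ r + y ^ r := by
        intro x y; simpa using h.add 1 x y
      have fr2 : ∀ x y : F, (x - y) ^ r = x ^ r - y ^ r := by
        intro x y; simpa using h.sub 1 x y
      have fr3 : ∀ x : F, (-x) ^ r = - x ^ r := by
        intro x; simpa using h.neg 1 x
      have hinj : Set.InjOn (fun z : F × F => z.1 + z.2 * v) (V ×ˢ K : Finset (F × F)) := by
        rintro ⟨y, c⟩ h1 ⟨y', c'⟩ h2 e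
        simp only [Finset.coe_product, Set.mem_prod, Finset.mem_coe, memK] at h1 h2
        simp only at e
        by_cases hcc : c = c'
        · subst hcc; simpa using e
        · exfalso
          apply hvV
          have h3 : c - c' ≠ 0 := sub_ne_zero.2 hcc
          have : v = (c - c')⁻¹ * (y' + -y) := by
            field_simp
            linear_combination e
          rw [this]
          refine Vsm _ ?_ _ (Vadd _ h2.1 _ (Vneg _ h1.1))
          rw [inv_pow, fr2, h1.2, h2.2]
      have hcardV' : V'.card = V.card * r := by
        rw [hV', Finset.card_image_of_injOn hinj, Finset.card_product, hKcard, pow_one]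
      refine ⟨V', ?_, ?_, ⟨?_, ?_, ?_, ?_⟩, ?_⟩
      · intro x hx
        obtain ⟨y, hy, c, hc, rfl⟩ := (memV' x).1 hx
        exact Uadd _ (hVU hy) _ (Usm _ hc _ hvU)
      · refine Finset.insert_subset ?_ fun x hx => ?_
        · exact (memV' _).2 ⟨0, V0, 1, one_pow _, by ring⟩
        · exact (memV' _).2 ⟨x, hSV hx, 0, zero_pow (by omega), by ring⟩
      · exact (memV' _).2 ⟨0, V0, 0, zero_pow (by omega), by ring⟩
      · intro x hx x' hx'
        obtain ⟨y, hy, c, hc, rfl⟩ := (memV' x).1 hx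
        obtain ⟨y', hy', c', hc', rfl⟩ := (memV' x').1 hx'
        exact (memV' _).2 ⟨y + y', Vadd _ hy _ hy', c + c', by rw [fr1, hc, hc'], by ring⟩
      · intro x hx
        obtain ⟨y, hy, c, hc, rfl⟩ := (memV' x).1 hx
        exact (memV' _).2 ⟨-y, Vneg _ hy, -c, by rw [fr3, hc], by ring⟩
      · intro a ha x hx
        obtain ⟨y, hy, c, hc, rfl⟩ := (memV' x).1 hx
        exact (memV' _).2 ⟨a * y, Vsm _ ha _ hy, a * c, by rw [mul_pow, hc, ha], by ring⟩
      · set A := ∏ u ∈ V, (X - C u) with hA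
        have hAm : A.Monic := monic_prodU V
        have hAd : A.natDegree = V.card := natDegree_prodU V
        have hVpos : 0 < V.card := Finset.card_pos.2 ⟨0, V0⟩
        have hdeg : (C (A.eval v ^ (r - 1)) * A).natDegree < (A ^ r).natDegree := by
          refine (natDegree_C_mul_le _ _).trans_lt ?_
          rw [hAm.natDegree_pow, hAd]
          nlinarith
        have hL : A ^ r - C (A.eval v ^ (r - 1)) * A = ∏ u ∈ V', (X - C u) := by
          apply eq_prod_of_roots
          · exact (hAm.pow r).sub_of_left (degree_lt_degree hdeg)
          · rw [natDegree_sub_eq_left_of_natDegree_lt hdeg, hAm.natDegree_pow, hAd, hcardV',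
              mul_comm]
          · intro x hx
            obtain ⟨y, hy, c, hc, rfl⟩ := (memV' x).1 hx
            have e1 : A.eval (y + c * v) = c * A.eval v := by
              rw [lin_eval_add h hlin, lin_eval_smul hlin hc, (eval_prodU V y).2 hy, zero_add]
            simp only [eval_sub, eval_pow, eval_mul, eval_C, e1, mul_pow, hc]
            obtain ⟨r', rfl⟩ : ∃ r', r = r' + 1 := ⟨r - 1, by omega⟩
            simp only [Nat.add_sub_cancel]
            ring
        rw [← hL]
        exact lin_sub hr (lin_pow h hlin) (lin_C_mul hr hlin _)
  obtain ⟨V, h1, h2, -, h3⟩ := key U subset_rfl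
  rwa [Finset.Subset.antisymm h1 h2] at h3

/-- part 2 -/
lemma part2 (h : FrobOK F r) {N d : ℕ} (hcard : Fintype.card F = r ^ N) (hN : 0 < N)
    (hdN : d ∣ N)
    (U : Finset F) (hU : IsSubspaceOver r (↑U : Set F)) (hdU : ∀ u ∈ U, u ^ r ^ d = u) :
    ∃ M : F[X], M.Monic ∧ IsLinearized r M ∧
      (∏ u ∈ U, (X - C u)).comp M = X ^ r ^ d - X ∧
      M.comp (∏ u ∈ U, (X - C u)) = X ^ r ^ d - X := by
  have hr := h.one_lt
  have hA := lin_prod h hcard hN U hU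
  set A := ∏ u ∈ U, (X - C u) with hAdef
  have hAm : A.Monic := monic_prodU U
  have hAd : A.natDegree = U.card := natDegree_prodU U
  have hUpos : 0 < U.card := Finset.card_pos.2 ⟨0, hU.1⟩
  set K := Finset.univ.filter (fun c : F => c ^ r ^ d = c) with hK
  have hKcard : K.card = r ^ d := card_fix hr hcard hN hdN
  have memK : ∀ c, c ∈ K ↔ c ^ r ^ d = c := by simp [hK]
  set W := K.image (fun x => A.eval x) with hW
  have hd0 : d ≠ 0 := by rintro rfl; simp at hdN; omega
  have hW' : IsSubspaceOver r (↑W : Set F) := by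
    have memW : ∀ x, x ∈ W ↔ ∃ y, y ^ r ^ d = y ∧ A.eval y = x := by simp [hW, memK]
    refine ⟨?_, ?_, ?_, ?_⟩
    · exact (memW _).2 ⟨0, zero_pow (h.ne d), lin_eval_zero h hA⟩
    · intro x hx y hy
      obtain ⟨x', hx', rfl⟩ := (memW _).1 hx
      obtain ⟨y', hy', rfl⟩ := (memW _).1 hy
      exact (memW _).2 ⟨x' + y', by rw [h.add, hx', hy'], lin_eval_add h hA _ _⟩
    · intro x hx
      obtain ⟨x', hx', rfl⟩ := (memW _).1 hx
      refine (memW _).2 ⟨-x', by rw [h.neg, hx'], ?_⟩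
      have := lin_eval_add h hA x' (-x')
      rw [add_neg_cancel, lin_eval_zero h hA] at this
      linear_combination -this
    · intro c hc x hx
      obtain ⟨x', hx', rfl⟩ := (memW _).1 hx
      exact (memW _).2 ⟨c * x', by rw [mul_pow, hx', pow_iter_fix hc], lin_eval_smul hA hc _⟩
  have hWcard : W.card * U.card = r ^ d := by
    rw [← hKcard, Finset.card_eq_sum_card_image (fun x => A.eval x) K, ← hW]
    symm
    refine Finset.sum_const_nat fun w hw => ?_
    obtain ⟨x, hx, rfl⟩ := Finset.mem_image.1 hw
    have : K.filter (fun y => A.eval y = A.eval x) = U.image (fun u => x + u) := by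
      ext y
      simp only [Finset.mem_filter, Finset.mem_image, memK]
      constructor
      · rintro ⟨_, e⟩
        refine ⟨y - x, ?_, by ring⟩
        rw [← eval_prodU, ← hAdef]
        have := lin_eval_add h hA (y - x) x
        rw [sub_add_cancel, e] at this
        linear_combination -this
      · rintro ⟨u, hu, rfl⟩
        refine ⟨by rw [h.add, (memK x).1 hx, hdU u hu], ?_⟩
        rw [lin_eval_add h hA, (eval_prodU U u).2 hu, add_zero]
    rw [this, Finset.card_image_of_injective _ (add_right_injective x)]
  have hM := lin_prod h hcard hN W hW'
  set M := ∏ u ∈ W, (X - C u) with hMdef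
  have hMm : M.Monic := monic_prodU W
  have hMA : M.comp A = X ^ r ^ d - X := by
    have e1 : M.comp A = ∏ x ∈ K, (X - C x) := by
      apply eq_prod_of_roots
      · exact hMm.comp hAm (by omega)
      · rw [natDegree_comp, hAd, hMdef, natDegree_prodU, hWcard, hKcard]
      · intro x hx
        rw [eval_comp, eval_prodU]
        exact Finset.mem_image_of_mem _ hx
    have hlt : 1 < r ^ d := Nat.one_lt_pow hd0 hr
    have e2 : (X ^ r ^ d - X : F[X]) = ∏ x ∈ K, (X - C x) := by
      apply eq_prod_of_roots
      · exact monic_X_pow_sub (by rw [degree_X]; exact_mod_cast hlt)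
      · rw [FiniteField.X_pow_card_pow_sub_X_natDegree_eq F hd0 hr, hKcard]
      · intro x hx
        simp [(memK x).1 hx]
    rw [e1, e2]
  refine ⟨M, hMm, hM, ?_, hMA⟩
  have hAQ : A.comp (X ^ r ^ d) = A ^ r ^ d := by
    rw [hAdef, ← Finset.prod_pow, prod_comp]
    refine Finset.prod_congr rfl fun u hu => ?_
    rw [h.subX, ← C_pow, hdU u hu]; simp
  have hsub : A.comp (X ^ r ^ d - X) = A ^ r ^ d - A := by
    have := lin_add h hA (X ^ r ^ d - X) X
    rw [sub_add_cancel, hAQ, comp_X] at this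
    rw [this]; ring
  have e3 : (A.comp M - (X ^ r ^ d - X)).comp A = 0 := by
    rw [sub_comp, comp_assoc, hMA, hsub]; simp
  rcases comp_eq_zero_iff.1 e3 with h4 | ⟨_, h4⟩
  · exact sub_eq_zero.1 h4
  · exfalso
    have := congrArg natDegree h4
    rw [natDegree_C] at this
    omega

end subspaces

section gap
variable {F : Type} [Field F] {r : ℕ}

lemma monom_of_dvd {P : F[X]} {n : ℕ} (h1 : X ^ n ∣ P) (h2 : P.natDegree ≤ n) :
    ∃ c, P = C c * X ^ n := by
  obtain ⟨R, rfl⟩ := h1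
  by_cases hR : R = 0
  · exact ⟨0, by simp [hR]⟩
  rw [natDegree_mul (pow_ne_zero _ X_ne_zero) hR, natDegree_X_pow] at h2
  obtain ⟨c, hc⟩ := natDegree_eq_zero.1 (show R.natDegree = 0 by omega)
  exact ⟨c, by rw [← hc]; ring⟩

lemma gap (h : FrobOK F r) {d m l : ℕ} (U : Finset F) (h0 : (0 : F) ∈ U) (h1 : (1 : F) ∈ U)
    (hA : IsLinearized r (∏ u ∈ U, (X - C u))) (hm : U.card = r ^ m) {M : F[X]}
    (hM : IsLinearized r M)
    (hAM : (∏ u ∈ U, (X - C u)).comp M = X ^ r ^ d - X) (hml : m ≤ l) (hld : l ≤ d)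
    (hz : ∀ s, l - m < s → s < l → M.coeff (r ^ s) = 0) : ∀ u ∈ U, u ^ r ^ l = u := by
  classical
  have hr := h.one_lt
  have hAd : (∏ u ∈ U, (X - C u)).natDegree = r ^ m := by rw [natDegree_prodU, hm]
  have hAe : ∀ u ∈ U, (∏ u ∈ U, (X - C u)).eval u = 0 := fun u hu => (eval_prodU U u).2 hu
  have hAX : (X : F[X]) ∣ ∏ u ∈ U, (X - C u) := by
    have := Finset.dvd_prod_of_mem (fun u => (X - C u : F[X])) h0
    simpa using this
  have hAprod : ∀ B : F[X], (∏ u ∈ U, (X - C u)).comp B = B * ∏ u ∈ U.erase 0, (B - C u) := by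
    intro B
    rw [prod_comp, ← Finset.mul_prod_erase U _ h0]
    simp
  have h0' : ∀ B : F[X], B ∣ (∏ u ∈ U, (X - C u)).comp B := fun B => ⟨_, hAprod B⟩
  set A := ∏ u ∈ U, (X - C u) with hAdef
  set μ := fun s => M.coeff (r ^ s) with hμ
  obtain ⟨T, hT1, hT2⟩ : ∃ T, M.natDegree < r ^ T ∧ l ≤ T := by
    refine ⟨M.natDegree + l + 1, ?_, by omega⟩
    exact lt_trans (by omega) (Nat.lt_pow_self hr)
  set M1 := ∑ s ∈ Finset.range l, C (μ s) * X ^ r ^ s with hM1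
  set M2 := ∑ s ∈ Finset.Ico l T, C (μ s) * X ^ r ^ s with hM2
  have hM12 : M = M1 + M2 := by
    rw [hM1, hM2, Finset.sum_range_add_sum_Ico _ hT2]
    exact lin_repr hr hM T hT1
  have hM1d : M1.natDegree ≤ r ^ (l - m) := by
    refine natDegree_sum_le_of_forall_le _ _ fun s hs => ?_
    have hs' := Finset.mem_range.1 hs
    by_cases hsl : l - m < s
    · have : μ s = 0 := hz s hsl hs'
      rw [this]; simp
    · refine (natDegree_C_mul_X_pow_le _ _).trans ?_
      exact Nat.pow_le_pow_right (by omega) (by omega)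
  have hM2d : X ^ r ^ l ∣ M2 := by
    refine Finset.dvd_sum fun s hs => ?_
    have := (Finset.mem_Ico.1 hs).1
    exact Dvd.dvd.mul_left (pow_dvd_pow _ (Nat.pow_le_pow_right (by omega) this)) _
  have hM10 : M1.eval 0 = 0 := by
    rw [hM1, eval_finsetSum]
    refine Finset.sum_eq_zero fun s _ => ?_
    rw [eval_mul, eval_pow, eval_X, zero_pow (h.ne s), mul_zero]
  have hP : A.comp M1 + X = X ^ r ^ d - A.comp M2 := by
    have : A.comp M1 + A.comp M2 = X ^ r ^ d - X := by rw [← lin_add h hA, ← hM12, hAM]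
    linear_combination this
  have hle : 1 ≤ r ^ l := Nat.one_le_pow _ _ (by omega)
  have hsplit : r ^ (l - m) * r ^ m = r ^ l := by rw [← pow_add]; congr 1; omega
  obtain ⟨κ, hκ⟩ : ∃ κ, A.comp M1 + X = C κ * X ^ r ^ l := by
    apply monom_of_dvd
    · rw [hP]
      exact dvd_sub (pow_dvd_pow _ (Nat.pow_le_pow_right (by omega) hld)) (hM2d.trans (h0' M2))
    · refine (natDegree_add_le _ _).trans (max_le ?_ ?_)
      · rw [natDegree_comp, hAd, ← hsplit, mul_comm]
        exact Nat.mul_le_mul_right _ hM1d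
      · rw [natDegree_X]; exact hle
  set B := M1.comp A + X with hB
  have hAB : A.comp B = C κ * A ^ r ^ l := by
    rw [hB, lin_add h hA, ← comp_assoc, comp_X]
    have := congrArg (fun P => P.comp A) hκ
    simpa using this
  have hB0 : B.eval 0 = 0 := by
    rw [hB]; simp [eval_comp, hAe 0 h0, hM10]
  obtain ⟨β, hβ⟩ : ∃ β, B = C β * X ^ r ^ l := by
    apply monom_of_dvd
    · have hd1 : X ^ r ^ l ∣ B * ∏ u ∈ U.erase 0, (B - C u) := by
        rw [← hAprod, hAB]
        exact Dvd.dvd.mul_left (pow_dvd_pow_of_dvd hAX _) _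
      refine prime_X.pow_dvd_of_dvd_mul_right _ ?_ hd1
      rw [X_dvd_iff, coeff_zero_eq_eval_zero, eval_prod, Finset.prod_eq_zero_iff]
      rintro ⟨u, hu, e⟩
      simp [hB0] at e
      simp [e] at hu
    · refine (natDegree_add_le _ _).trans (max_le ?_ ?_)
      · rw [natDegree_comp, hAd, ← hsplit]
        exact Nat.mul_le_mul_right _ hM1d
      · rw [natDegree_X]; exact hle
  have hev : ∀ u ∈ U, u = β * u ^ r ^ l := by
    intro u hu
    have : B.eval u = u := by
      rw [hB]; simp [eval_comp, hAe u hu, hM10]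
    rw [hβ] at this
    simpa using this.symm
  have hb1 : β = 1 := by simpa using (hev 1 h1).symm
  intro u hu
  have := hev u hu
  rw [hb1, one_mul] at this
  exact this.symm

end gap

section eps
variable {F : Type} [Field F] [Fintype F] [DecidableEq F] {r : ℕ}

noncomputable def eps (g : F[X]) (r j t : ℕ) : F :=
  ∑ x : Fˣ, (g.eval (x : F)) ^ r ^ t * ((x⁻¹ : Fˣ) : F) ^ j

lemma eps_mod (g : F[X]) (t : ℕ) {j j' : ℕ} (h : j ≡ j' [MOD Fintype.card F - 1]) :
    eps g r j t = eps g r j' t := by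
  unfold eps
  refine Finset.sum_congr rfl fun x _ => ?_
  congr 1
  norm_cast
  rw [pow_eq_pow_iff_modEq]
  refine h.of_dvd ?_
  rw [← Fintype.card_units]
  exact orderOf_dvd_card

lemma eps_zero (g : F[X]) (hg : g.natDegree < Fintype.card F - 1) (j : ℕ) :
    eps g r j 0 = - g.coeff (j % (Fintype.card F - 1)) := by
  unfold eps
  set Q := Fintype.card F - 1 with hQ
  have hQ0 : 0 < Q := by omega
  have hinv : ∀ x : Fˣ, ((x⁻¹ : Fˣ) : F) ^ j = (x : F) ^ ((Q - 1) * j) := by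
    intro x
    have : x ^ Q = 1 := by rw [hQ, ← Fintype.card_units]; exact pow_card_eq_one
    have h2 : x⁻¹ = x ^ (Q - 1) := by
      rw [inv_eq_iff_mul_eq_one, ← pow_succ', Nat.sub_add_cancel hQ0, this]
    rw [h2, pow_mul]; simp
  have e : ∀ x : Fˣ, (g.eval (x : F)) ^ r ^ 0 * ((x⁻¹ : Fˣ) : F) ^ j
      = ∑ i ∈ Finset.range Q, g.coeff i * (x : F) ^ (i + (Q - 1) * j) := by
    intro x
    rw [hinv, pow_zero, pow_one, eval_eq_sum_range' hg, Finset.sum_mul]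
    exact Finset.sum_congr rfl fun i _ => by ring
  rw [Finset.sum_congr rfl fun x _ => e x, Finset.sum_comm]
  have e2 : ∀ i ∈ Finset.range Q, ∑ x : Fˣ, g.coeff i * (x : F) ^ (i + (Q - 1) * j)
      = if i = j % Q then - g.coeff i else 0 := by
    intro i hi
    have hi' := Finset.mem_range.1 hi
    rw [← Finset.mul_sum, FiniteField.sum_pow_units]
    have : (Fintype.card F - 1 ∣ i + (Q - 1) * j) ↔ i = j % Q := by
      rw [← hQ, ← Nat.modEq_zero_iff_dvd]
      have hj : j + (Q - 1) * j ≡ 0 [MOD Q] := by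
        rw [Nat.modEq_zero_iff_dvd]
        refine ⟨j, ?_⟩
        obtain ⟨Q', hQ'⟩ : ∃ Q', Q = Q' + 1 := ⟨Q - 1, by omega⟩
        rw [hQ']; simp; ring
      constructor
      · intro hh
        have := Nat.ModEq.add_right_cancel' _ (hh.trans hj.symm)
        rw [← Nat.mod_eq_of_lt hi']; exact this
      · intro hh
        have : i ≡ j [MOD Q] := by rw [hh]; exact Nat.mod_modEq _ _
        exact (this.add_right _).trans hj
    simp only [this]
    split_ifs <;> simp
  rw [Finset.sum_congr rfl e2, Finset.sum_ite_eq', if_pos (Finset.mem_range.2 (Nat.mod_lt _ hQ0))]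

lemma eps_shift (h : FrobOK F r) (g : F[X]) (j s t : ℕ) :
    eps g r (j * r ^ t) (s + t) = eps g r j s ^ r ^ t := by
  unfold eps
  rw [h.sum]
  refine Finset.sum_congr rfl fun x _ => ?_
  rw [mul_pow, ← pow_mul, ← pow_mul, ← pow_add]

lemma eps_per (g : F[X]) {d : ℕ} (hg : ∀ x, g.eval x ^ r ^ d = g.eval x) (j t : ℕ) :
    eps g r j (t + d) = eps g r j t := by
  unfold eps
  refine Finset.sum_congr rfl fun x _ => ?_
  rw [add_comm, pow_add, pow_mul, hg]

lemma eps_per' (g : F[X]) {d : ℕ} (hg : ∀ x, g.eval x ^ r ^ d = g.eval x) (j : ℕ) {t t' : ℕ}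
    (ht : t ≡ t' [MOD d]) : eps g r j t = eps g r j t' := by
  have : ∀ c s, eps g r j (s + d * c) = eps g r j s := by
    intro c
    induction c with
    | zero => simp
    | succ c ih => intro s; rw [mul_add, mul_one, ← add_assoc, eps_per g hg, ih]
  rw [← Nat.mod_add_div t d, ← Nat.mod_add_div t' d, this, this, ht]

lemma eps_rec (h : FrobOK F r) (g A : F[X]) (hA : IsLinearized r A) (m : ℕ)
    (hd : A.natDegree < r ^ (m + 1)) (hg : ∀ x, A.eval (g.eval x) = 0) (j s : ℕ) :
    ∑ i ∈ Finset.range (m + 1), A.coeff (r ^ i) ^ r ^ s * eps g r j (s + i) = 0 := by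
  unfold eps
  simp only [Finset.mul_sum]
  rw [Finset.sum_comm]
  refine Finset.sum_eq_zero fun x _ => ?_
  have := hg x
  rw [lin_repr h.one_lt hA _ hd] at this
  simp only [eval_finsetSum, eval_mul, eval_C, eval_pow, eval_X] at this
  have h2 := congrArg (fun y => y ^ r ^ s * ((x⁻¹ : Fˣ) : F) ^ j) this
  simp only [h.sum, zero_pow (h.ne s), zero_mul, Finset.sum_mul] at h2
  rw [← h2]
  refine Finset.sum_congr rfl fun i _ => ?_
  rw [mul_pow, ← pow_mul, ← pow_add, add_comm s i]
  ring

lemma eps_digit (h : FrobOK F r) (g : F[X]) {N B : ℕ} (hcard : Fintype.card F = r ^ N)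
    (hg : g.natDegree < Fintype.card F - 1) (hB : g.natDegree < B) {j t : ℕ}
    (hj : j < Fintype.card F - 1) (ht : t ≤ N) (hne : eps g r j t ≠ 0) :
    (j % r ^ t) * r ^ (N - t) < B := by
  have hr := h.one_lt
  set j' := j / r ^ t + (j % r ^ t) * r ^ (N - t) with hj'
  have hrt : 0 < r ^ t := by positivity
  have hsplit : r ^ (N - t) * r ^ t = r ^ N := by rw [← pow_add]; congr 1; omega
  have hrN : r ^ N = (Fintype.card F - 1) + 1 := by omega
  have e1 : j' * r ^ t = j + (j % r ^ t) * (Fintype.card F - 1) := by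
    have h1 := Nat.div_add_mod j (r ^ t)
    calc j' * r ^ t = r ^ t * (j / r ^ t) + (j % r ^ t) * (r ^ (N - t) * r ^ t) := by
          rw [hj']; ring
      _ = r ^ t * (j / r ^ t) + (j % r ^ t) * ((Fintype.card F - 1) + 1) := by rw [hsplit, hrN]
      _ = (r ^ t * (j / r ^ t) + j % r ^ t) + (j % r ^ t) * (Fintype.card F - 1) := by ring
      _ = _ := by rw [h1]
  have e2 : j' * r ^ t ≡ j [MOD Fintype.card F - 1] := by
    rw [e1]; simp [Nat.ModEq]
  have e3 : eps g r j t = (eps g r j' 0) ^ r ^ t := by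
    rw [← eps_shift h, zero_add]
    exact (eps_mod g t e2).symm
  rw [e3, eps_zero g hg] at hne
  have e4 : g.coeff (j' % (Fintype.card F - 1)) ≠ 0 := by
    intro hh; rw [hh, neg_zero, zero_pow hrt.ne'] at hne; exact hne rfl
  have e5 := le_natDegree_of_ne_zero e4
  have e6 : j' < r ^ N := by
    have h1 : j / r ^ t < r ^ (N - t) := by
      rw [Nat.div_lt_iff_lt_mul hrt, hsplit]; omega
    have h2 : j % r ^ t + 1 ≤ r ^ t := Nat.mod_lt _ hrt
    calc j' < r ^ (N - t) + (j % r ^ t) * r ^ (N - t) := by rw [hj']; omega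
      _ = (j % r ^ t + 1) * r ^ (N - t) := by ring
      _ ≤ r ^ t * r ^ (N - t) := Nat.mul_le_mul_right _ h2
      _ = r ^ N := by rw [mul_comm, hsplit]
  have e7 : j' < Fintype.card F - 1 := by
    by_contra hcon
    have h1 : j' = Fintype.card F - 1 := by omega
    rw [h1] at e2
    have h2 : 0 ≡ j [MOD Fintype.card F - 1] := by
      refine Nat.ModEq.trans ?_ e2
      simp [Nat.ModEq]
    have h3 : j = 0 := by
      have := h2.symm
      rw [Nat.ModEq, Nat.mod_eq_of_lt hj] at this
      simpa using this
    rw [h3] at hj'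
    simp at hj'
    omega
  rw [Nat.mod_eq_of_lt e7] at e5
  have : (j % r ^ t) * r ^ (N - t) ≤ j' := Nat.le_add_left _ _
  omega
end eps

lemma dvd_of_digits {r : ℕ} (hr : 1 < r) (l : ℕ) : ∀ j : ℕ, (∀ b, b < l → j / r ^ b % r = 0) →
    r ^ l ∣ j := by
  induction l with
  | zero => intro j _; simp
  | succ l ih =>
    intro j hj
    obtain ⟨c, rfl⟩ := ih j fun b hb => hj b (by omega)
    have := hj l (by omega)
    rw [Nat.mul_div_cancel_left _ (by positivity)] at this
    rw [pow_succ]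
    exact Nat.mul_dvd_mul_left _ (Nat.dvd_of_mod_eq_zero this)

lemma topdigit {r J : ℕ} (hr : 1 < r) (hJ : 0 < J) : J / r ^ (Nat.log r J) % r ≠ 0 := by
  have h1 := Nat.pow_log_le_self r hJ.ne'
  have h2 := Nat.lt_pow_succ_log_self hr J
  have h3 : 0 < J / r ^ Nat.log r J := Nat.div_pos h1 (by positivity)
  have h4 : J / r ^ Nat.log r J < r := by
    rw [Nat.div_lt_iff_lt_mul (by positivity)]
    rwa [Nat.succ_eq_add_one, pow_succ, mul_comm] at h2
  rw [Nat.mod_eq_of_lt h4]; omega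

lemma log_shift {r J l : ℕ} (hr : 1 < r) (hJ : 0 < J) : Nat.log r (J * r ^ l) = Nat.log r J + l := by
  induction l with
  | zero => simp
  | succ l ih =>
    rw [pow_succ, ← mul_assoc, Nat.log_mul_base hr (by positivity), ih]; omega

lemma digit_shift {r : ℕ} (hr : 1 < r) (j l b : ℕ) :
    (j * r ^ l) / r ^ (b + l) = j / r ^ b := by
  rw [pow_add, Nat.mul_div_mul_right _ _ (by positivity)]

lemma deg_bound {r d : ℕ} (hr : 1 < r) (hd : 0 < d) (w : ℕ) : ∀ J : ℕ,
    (∀ b, J / r ^ b % r ≠ 0 → d ∣ b ∧ J / r ^ b % r = 1) → J < (r ^ d) ^ w →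
    J * (r ^ d - 1) + 1 ≤ (r ^ d) ^ w := by
  induction w with
  | zero => intro J _ hJ; simp at hJ; simp [hJ]
  | succ w ih =>
    intro J hJ hlt
    have hQ : 0 < r ^ d := by positivity
    have h1 : J / r ^ d < (r ^ d) ^ w := by
      rw [Nat.div_lt_iff_lt_mul hQ, ← pow_succ]; exact hlt
    have h2 := ih (J / r ^ d) (by
      intro b hb
      rw [Nat.div_div_eq_div_mul, ← pow_add] at hb ⊢
      obtain ⟨h3, h4⟩ := hJ _ hb
      exact ⟨(Nat.dvd_add_right (dvd_refl d)).1 h3, h4⟩) h1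
    have h3 : J % r ^ d ≤ 1 := by
      obtain ⟨e, rfl⟩ : ∃ e, d = e + 1 := ⟨d - 1, by omega⟩
      have : r ^ e ∣ J / r := by
        refine dvd_of_digits hr _ _ fun b hb => ?_
        by_contra hne
        rw [Nat.div_div_eq_div_mul, ← pow_succ'] at hne
        have := Nat.le_of_dvd (by omega) (hJ _ hne).1
        omega
      rw [pow_succ', Nat.mod_mul, Nat.mod_eq_zero_of_dvd this, mul_zero, add_zero]
      by_cases h0 : J % r = 0
      · omega
      · have := (hJ 0 (by simpa using h0)).2
        simp at this; omega
    have h4 := Nat.div_add_mod J (r ^ d)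
    set Q := r ^ d
    set J' := J / Q
    obtain ⟨Q', hQ'⟩ : ∃ Q', Q = Q' + 1 := ⟨Q - 1, by omega⟩
    have h5 : J ≤ Q * J' + 1 := by omega
    calc J * (Q - 1) + 1 ≤ (Q * J' + 1) * (Q - 1) + 1 := by gcongr
      _ = (J' * (Q - 1) + 1) * Q := by
        rw [hQ', Nat.add_sub_cancel]; ring
      _ ≤ Q ^ w * Q := Nat.mul_le_mul_right _ h2
      _ = Q ^ (w + 1) := (pow_succ _ _).symm

section key
set_option linter.unusedSectionVars false
variable {F : Type} [Field F] [Fintype F] [DecidableEq F] {r N d m : ℕ} {U : Finset F} {M g : F[X]}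

structure Setup (r N d m : ℕ) (U : Finset F) (M g : F[X]) : Prop where
  h : FrobOK F r
  hcard : Fintype.card F = r ^ N
  hN : 0 < N
  hdN : d ∣ N
  hd : 0 < d
  h0 : (0 : F) ∈ U
  h1 : (1 : F) ∈ U
  hm : U.card = r ^ m
  hm1 : 1 ≤ m
  hmN : m ≤ N
  hA : IsLinearized r (∏ u ∈ U, (X - C u))
  hM : IsLinearized r M
  hAM : (∏ u ∈ U, (X - C u)).comp M = X ^ r ^ d - X
  hdU : ∀ u ∈ U, u ^ r ^ d = u
  hmin : ∀ d', 0 < d' → (∀ u ∈ U, u ^ r ^ d' = u) → d ≤ d'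
  gdeg : g.natDegree < 2 * r ^ (N - m)
  gdeg' : g.natDegree < r ^ N - 1
  gU : ∀ x, g.eval x ∈ U
  g0 : g.coeff 0 = 0

namespace Setup

lemma per (S : Setup r N d m U M g) (x : F) : g.eval x ^ r ^ d = g.eval x := S.hdU _ (S.gU x)

lemma am (S : Setup r N d m U M g) : (∏ u ∈ U, (X - C u)).coeff (r ^ m) = 1 := by
  have := monic_prodU U
  rw [Monic, leadingCoeff, natDegree_prodU, S.hm] at this
  exact this

lemma agt (S : Setup r N d m U M g) (i : ℕ) (hi : m < i) :
    (∏ u ∈ U, (X - C u)).coeff (r ^ i) = 0 := by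
  apply coeff_eq_zero_of_natDegree_lt
  rw [natDegree_prodU, S.hm]
  exact Nat.pow_lt_pow_right S.h.one_lt hi

lemma conv (S : Setup r N d m U M g) (t : ℕ) (h0 : 0 < t) (ht : t < d) :
    ∑ i ∈ Finset.range (t + 1), (∏ u ∈ U, (X - C u)).coeff (r ^ i) *
      (M.coeff (r ^ (t - i))) ^ r ^ i = 0 := by
  have hr := S.h.one_lt
  rw [← comp_coeff S.h S.hA S.hM, S.hAM, coeff_sub, coeff_X_pow, coeff_X, if_neg, if_neg, sub_zero]
  · exact (Nat.one_lt_pow h0.ne' hr).ne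
  · exact (Nat.pow_lt_pow_right hr ht).ne

lemma a0mu0 (S : Setup r N d m U M g) :
    (∏ u ∈ U, (X - C u)).coeff (r ^ 0) * M.coeff (r ^ 0) = -1 := by
  have hr := S.h.one_lt
  have := comp_coeff S.h S.hA S.hM 0
  rw [S.hAM, coeff_sub, coeff_X_pow, coeff_X, if_neg, if_pos (by simp)] at this
  · simp at this; simp [← this]
  · exact (Nat.pow_lt_pow_right hr S.hd).ne

lemma a0 (S : Setup r N d m U M g) : (∏ u ∈ U, (X - C u)).coeff (r ^ 0) ≠ 0 := by
  intro hh; have := S.a0mu0; rw [hh] at this; simp at this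

lemma mu0 (S : Setup r N d m U M g) : M.coeff (r ^ 0) ≠ 0 := by
  intro hh; have := S.a0mu0; rw [hh] at this; simp at this

lemma recur (S : Setup r N d m U M g) (j s : ℕ) :
    ∑ i ∈ Finset.range (m + 1), (∏ u ∈ U, (X - C u)).coeff (r ^ i) ^ r ^ s *
      eps g r j (s + i) = 0 := by
  refine eps_rec S.h g _ S.hA m ?_ (fun x => (eval_prodU U _).2 (S.gU x)) j s
  rw [natDegree_prodU, S.hm]
  exact Nat.pow_lt_pow_right S.h.one_lt (by omega)

lemma linS (S : Setup r N d m U M g) (j b : ℕ) (hz : ∀ i, 1 ≤ i → i < m → eps g r j (b + i) = 0) :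
    ∀ l, l < d → eps g r j (b + d - l) =
      eps g r j b / M.coeff (r ^ 0) ^ r ^ (b + d) * M.coeff (r ^ l) ^ r ^ (b + d - l) :=
  linP S.h (eps g r j) (fun i => (∏ u ∈ U, (X - C u)).coeff (r ^ i)) (fun i => M.coeff (r ^ i))
    m d b (S.recur j) (eps_per g S.per j) S.agt S.conv S.a0 S.mu0 hz

lemma eps0 (S : Setup r N d m U M g) {j : ℕ} (hj : j < r ^ N) : eps g r j 0 = - g.coeff j := by
  rw [eps_zero g (by rw [S.hcard]; exact S.gdeg'), S.hcard]
  by_cases hj' : j < r ^ N - 1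
  · rw [Nat.mod_eq_of_lt hj']
  · have : j = r ^ N - 1 := by omega
    rw [this, Nat.mod_self, S.g0, coeff_eq_zero_of_natDegree_lt S.gdeg']

lemma P1 (S : Setup r N d m U M g) {j b : ℕ} (hj : g.coeff j ≠ 0) (hb : j / r ^ b % r ≠ 0) :
    (∀ i, 1 ≤ i → i < m → eps g r j (b + i) = 0) ∧ eps g r j b ≠ 0 ∧ j / r ^ b % r = 1 := by
  have hr := S.h.one_lt
  have hjd := le_natDegree_of_ne_zero hj
  have hj1 := S.gdeg
  have hj2 := S.gdeg'
  have hrb : 0 < r ^ b := by positivity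
  have hbj : r ^ b ≤ j := by
    by_contra hcon
    rw [Nat.div_eq_of_lt (by omega)] at hb; simp at hb
  have hm1 := S.hm1
  have hmN := S.hmN
  have hbN : b ≤ N - m := by
    by_contra hcon
    have h1 : r ^ (N - m + 1) ≤ r ^ b := Nat.pow_le_pow_right (by omega) (by omega)
    have h2 : 2 * r ^ (N - m) ≤ r ^ (N - m + 1) := by
      rw [pow_succ']; exact Nat.mul_le_mul_right _ hr
    omega
  have hDi : ∀ i, 1 ≤ i → j / r ^ b % r ≤ j / r ^ b % r ^ i := by
    intro i hi
    obtain ⟨e, rfl⟩ : ∃ e, i = e + 1 := ⟨i - 1, by omega⟩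
    rw [pow_succ', Nat.mod_mul]; omega
  have dig : ∀ i, 1 ≤ i → i ≤ m → eps g r j (b + i) ≠ 0 →
      (j / r ^ b % r ^ i) * r ^ (N - i) < 2 * r ^ (N - m) := by
    intro i hi him hne
    have h1 := eps_digit S.h g S.hcard (by rw [S.hcard]; exact hj2) hj1 (j := j) (t := b + i)
      (by rw [S.hcard]; omega) (by omega) hne
    refine lt_of_le_of_lt ?_ h1
    have h2 : r ^ (N - i) = r ^ b * r ^ (N - (b + i)) := by
      rw [← pow_add]; congr 1; omega
    rw [h2, pow_add, Nat.mod_mul, ← mul_assoc]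
    refine Nat.mul_le_mul_right _ ?_
    rw [mul_comm]; exact Nat.le_add_left _ _
  have hz : ∀ i, 1 ≤ i → i < m → eps g r j (b + i) = 0 := by
    intro i hi him
    by_contra hne
    have h1 := dig i hi him.le hne
    have h2 : 2 * r ^ (N - m) ≤ r ^ (N - i) := by
      calc 2 * r ^ (N - m) ≤ r * r ^ (N - m) := Nat.mul_le_mul_right _ hr
        _ = r ^ (N - m + 1) := (pow_succ' _ _).symm
        _ ≤ _ := Nat.pow_le_pow_right (by omega) (by omega)
    have h3 : 1 * r ^ (N - i) ≤ (j / r ^ b % r ^ i) * r ^ (N - i) := by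
      refine Nat.mul_le_mul_right _ ?_
      have := hDi i hi; omega
    omega
  have hd := S.hd
  have hb0 : eps g r j b ≠ 0 := by
    intro h0
    have h1 := S.linS j b hz (b % d) (Nat.mod_lt _ hd)
    rw [h0, zero_div, zero_mul, eps_per' g S.per j (t' := 0), S.eps0 (by omega)] at h1
    · exact hj (by simpa using h1)
    · rw [Nat.modEq_zero_iff_dvd]
      have : b + d - b % d = d * (b / d) + d := by
        have := Nat.mod_add_div b d
        omega
      rw [this]
      exact Dvd.intro (b / d + 1) (by ring)
  refine ⟨hz, hb0, ?_⟩
  have hbm : eps g r j (b + m) ≠ 0 := by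
    intro h0
    have h1 := S.recur j b
    rw [Finset.sum_range_succ, h0, mul_zero, add_zero] at h1
    rw [Finset.sum_eq_single 0] at h1
    · simp only [add_zero, mul_eq_zero, hb0, or_false] at h1
      exact S.a0 (pow_eq_zero_iff (S.h.ne b) |>.1 h1)
    · intro i hi hi0
      rw [hz i (by omega) (Finset.mem_range.1 hi), mul_zero]
    · intro hh; exact absurd (Finset.mem_range.2 hm1) hh
  have h1 := dig m hm1 le_rfl hbm
  have h2 := Nat.lt_of_mul_lt_mul_right h1
  have := hDi m hm1
  omega

lemma P2 (S : Setup r N d m U M g) {j b b' : ℕ} (hj : g.coeff j ≠ 0) (hb : j / r ^ b % r ≠ 0)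
    (hb' : j / r ^ b' % r ≠ 0) : b ≡ b' [MOD d] := by
  have hd := S.hd
  obtain ⟨hz, hne, -⟩ := S.P1 hj hb
  obtain ⟨hz', -, -⟩ := S.P1 hj hb'
  have hL := S.linS j b hz
  obtain ⟨l, hld, hl⟩ : ∃ l, l < d ∧ l + b' ≡ b [MOD d] := by
    refine ⟨(b + (d - 1) * b') % d, Nat.mod_lt _ hd, ?_⟩
    refine ((Nat.mod_modEq _ _).add_right _).trans ?_
    have : b + (d - 1) * b' + b' = b + d * b' := by
      obtain ⟨e, rfl⟩ : ∃ e, d = e + 1 := ⟨d - 1, by omega⟩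
      rw [Nat.add_sub_cancel]; ring
    rw [this]; simp [Nat.ModEq]
  by_cases hl0 : l = 0
  · rw [hl0, zero_add] at hl; exact hl.symm
  exfalso
  have hmu : ∀ i, 1 ≤ i → i < m → i ≤ l → M.coeff (r ^ (l - i)) = 0 := by
    intro i hi him hil
    have h1 := hL (l - i) (by omega)
    have h2 : eps g r j (b + d - (l - i)) = eps g r j (b' + i) := by
      refine eps_per' g S.per j ?_
      refine Nat.ModEq.add_right_cancel' l ?_
      have e1 : b + d - (l - i) + l = b + (d + i) := by omega
      have e2 : b' + i + l = (l + b') + i := by omega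
      rw [e1, e2]
      refine Nat.ModEq.trans ?_ (hl.symm.add_right i)
      rw [← add_assoc, add_right_comm]
      simp [Nat.ModEq]
    rw [h2, hz' i hi him] at h1
    have h3 := (mul_eq_zero.1 h1.symm).resolve_left
      (div_ne_zero hne (pow_ne_zero _ S.mu0))
    exact (pow_eq_zero_iff (S.h.ne _)).1 h3
  by_cases hlm : l < m
  · have := hmu l (by omega) hlm le_rfl
    rw [Nat.sub_self] at this
    exact S.mu0 this
  · have := gap S.h U S.h0 S.h1 S.hA S.hm S.hM S.hAM (l := l) (by omega) hld.le (by
      intro s hs1 hs2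
      have := hmu (l - s) (by omega) (by omega) (by omega)
      rwa [show l - (l - s) = s by omega] at this)
    have := S.hmin l (by omega) this
    omega

lemma Jbound (S : Setup r N d m U M g) {J l : ℕ} (hJ0 : 0 < J) (hJN : J < r ^ N)
    (hJ : ∀ b, J / r ^ b % r ≠ 0 → d ∣ b) (hl : l < d) : J * r ^ l < r ^ N := by
  have hr := S.h.one_lt
  have h1 := hJ _ (topdigit hr hJ0)
  have h2 : Nat.log r J < N := (Nat.log_lt_iff_lt_pow hr hJ0.ne').2 hJN
  have h3 : Nat.log r J + d ≤ N := by
    obtain ⟨x, hx⟩ := h1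
    obtain ⟨y, hy⟩ := S.hdN
    rw [hx, hy] at h2 ⊢
    have := Nat.lt_of_mul_lt_mul_left h2
    calc d * x + d = d * (x + 1) := by ring
      _ ≤ _ := Nat.mul_le_mul_left _ this
  have h4 : J < r ^ (Nat.log r J + 1) := Nat.lt_pow_succ_log_self hr J
  calc J * r ^ l < r ^ (Nat.log r J + 1) * r ^ l := Nat.mul_lt_mul_of_pos_right h4 (by positivity)
    _ = r ^ (Nat.log r J + 1 + l) := (pow_add _ _ _).symm
    _ ≤ _ := Nat.pow_le_pow_right (by omega) (by omega)

lemma powN (S : Setup r N d m U M g) (x : F) : x ^ r ^ N = x := by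
  rw [← S.hcard]; exact FiniteField.pow_card x

lemma P3 (S : Setup r N d m U M g) {J l : ℕ} (hJ0 : 0 < J) (hJN : J < r ^ N)
    (hJ : ∀ b, J / r ^ b % r ≠ 0 → d ∣ b) (hl : l < d) :
    g.coeff (J * r ^ l) = (g.coeff J / M.coeff (r ^ 0)) ^ r ^ l * M.coeff (r ^ l) := by
  have hr := S.h.one_lt
  have hb := S.Jbound hJ0 hJN hJ hl
  have htop := hJ _ (topdigit hr hJ0)
  have hdN : d ≤ N := Nat.le_of_dvd S.hN S.hdN
  have claim : (∀ i, 1 ≤ i → i < m → eps g r J i = 0) →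
      g.coeff (J * r ^ l) = (g.coeff J / M.coeff (r ^ 0)) ^ r ^ l * M.coeff (r ^ l) := by
    intro hz
    have e1 := eps_shift S.h g (J * r ^ l) 0 (N - l)
    have e2 : J * r ^ l * r ^ (N - l) = J + J * (Fintype.card F - 1) := by
      rw [mul_assoc, ← pow_add, show l + (N - l) = N by omega, S.hcard]
      obtain ⟨Q, hQ⟩ : ∃ Q, r ^ N = Q + 1 := ⟨r ^ N - 1, by omega⟩
      rw [hQ, Nat.add_sub_cancel]; ring
    rw [e2, zero_add, eps_mod g (j' := J) _ (by simp [Nat.ModEq]), S.eps0 hb] at e1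
    have e3 := S.linS J (N - d) (fun i h1 h2 => by
      rw [← hz i h1 h2]
      refine eps_per' g S.per J ?_
      have : N - d ≡ 0 [MOD d] := by
        rw [Nat.modEq_zero_iff_dvd]; exact Nat.dvd_sub S.hdN (dvd_refl d)
      simpa using this.add_right i) l hl
    have e4 : eps g r J (N - d) = eps g r J 0 := by
      refine eps_per' g S.per J ?_
      rw [Nat.modEq_zero_iff_dvd]; exact Nat.dvd_sub S.hdN (dvd_refl d)
    rw [Nat.sub_add_cancel hdN, S.powN, e4, S.eps0 hJN, e1] at e3
    have e5 := congrArg (fun y => y ^ r ^ l) e3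
    simp only [mul_pow] at e5
    rw [← pow_mul, ← pow_mul, ← pow_add, Nat.sub_add_cancel (by omega), S.powN, S.powN, neg_div,
      S.h.neg] at e5
    linear_combination -e5
  by_cases h1 : g.coeff J = 0
  · by_cases h2 : g.coeff (J * r ^ l) = 0
    · rw [h1, h2, zero_div, zero_pow (S.h.ne l), zero_mul]
    · apply claim
      have h3 := (S.P1 h2 (b := Nat.log r J + l)
        (by rw [digit_shift hr]; exact topdigit hr hJ0)).1
      intro i hi him
      have h4 := h3 i hi him
      rw [add_right_comm, eps_shift S.h] at h4
      have h5 := (pow_eq_zero_iff (S.h.ne _)).1 h4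
      rw [← h5]
      refine eps_per' g S.per J ?_
      have : Nat.log r J ≡ 0 [MOD d] := Nat.modEq_zero_iff_dvd.2 htop
      simpa using (this.add_right i).symm
  · apply claim
    have h3 := (S.P1 h1 (topdigit hr hJ0)).1
    intro i hi him
    rw [← h3 i hi him]
    refine eps_per' g S.per J ?_
    have : Nat.log r J ≡ 0 [MOD d] := Nat.modEq_zero_iff_dvd.2 htop
    simpa using (this.add_right i).symm

lemma key (S : Setup r N d m U M g) (hMm : M.Monic) :
    ∃ f : F[X], M.comp f = g ∧ f.natDegree * (r ^ d - 1) ≤ r ^ N - 1 := by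
  classical
  have hr := S.h.one_lt
  have hd := S.hd
  set T := (Finset.range (r ^ N)).filter (fun J => 0 < J ∧ ∀ b, J / r ^ b % r ≠ 0 → d ∣ b) with hT
  have hTm : ∀ J, J ∈ T ↔ J < r ^ N ∧ 0 < J ∧ ∀ b, J / r ^ b % r ≠ 0 → d ∣ b := by
    intro J; rw [hT, Finset.mem_filter, Finset.mem_range]
  refine ⟨∑ J ∈ T, C (g.coeff J / M.coeff (r ^ 0)) * X ^ J, ?_, ?_⟩
  · have hMd : M.natDegree < r ^ d := by
      have h1 := congrArg natDegree S.hAM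
      rw [natDegree_comp, natDegree_prodU, S.hm,
        FiniteField.X_pow_card_sub_X_natDegree_eq _ (Nat.one_lt_pow hd.ne' hr)] at h1
      have h2 : 1 < r ^ m := Nat.one_lt_pow (by have := S.hm1; omega) hr
      have h3 : 0 < M.natDegree := by
        rcases Nat.eq_zero_or_pos M.natDegree with h | h
        · rw [h, mul_zero] at h1
          exact absurd h1.symm (S.h.ne d)
        · exact h
      rw [← h1]; exact (Nat.lt_mul_iff_one_lt_left h3).2 h2
    have e1 : M.comp (∑ J ∈ T, C (g.coeff J / M.coeff (r ^ 0)) * X ^ J) =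
        ∑ l ∈ Finset.range d, ∑ J ∈ T, C (g.coeff (J * r ^ l)) * X ^ (J * r ^ l) := by
      have e0 : ∀ P : F[X], M.comp P =
          ∑ l ∈ Finset.range d, (C (M.coeff (r ^ l)) * X ^ r ^ l).comp P := by
        intro P
        conv_lhs => rw [lin_repr hr S.hM d hMd]
        rw [sum_comp]
      rw [e0]
      refine Finset.sum_congr rfl fun l hl => ?_
      rw [mul_comp, C_comp, X_pow_comp, S.h.sumX, Finset.mul_sum]
      refine Finset.sum_congr rfl fun J hJ => ?_
      obtain ⟨h1, h2, h3⟩ := (hTm J).1 hJ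
      rw [S.P3 h2 h1 h3 (Finset.mem_range.1 hl), mul_pow, ← C_pow, ← pow_mul, ← mul_assoc, ← C_mul]
      rw [mul_comm (M.coeff (r ^ l))]
    rw [e1]
    ext j
    simp only [finsetSum_coeff, coeff_C_mul_X_pow]
    by_cases hj : g.coeff j = 0
    · rw [hj]
      refine Finset.sum_eq_zero fun l _ => Finset.sum_eq_zero fun J _ => ?_
      split_ifs with hh
      · rw [← hh, hj]
      · rfl
    have hj0 : 0 < j := by
      rcases Nat.eq_zero_or_pos j with h | h
      · rw [h] at hj; exact absurd S.g0 hj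
      · exact h
    have hjN : j < r ^ N := by
      have := le_natDegree_of_ne_zero hj
      have := S.gdeg'
      omega
    set l0 := Nat.log r j % d with hl0
    have hdig : ∀ b, j / r ^ b % r ≠ 0 → b ≡ l0 [MOD d] := fun b hb =>
      (S.P2 hj hb (topdigit hr hj0)).trans (Nat.mod_modEq _ _).symm
    have hl0d : l0 < d := Nat.mod_lt _ hd
    have hdvd : r ^ l0 ∣ j := by
      refine dvd_of_digits hr _ _ fun b hb => ?_
      by_contra hne
      have := hdig b hne
      rw [Nat.ModEq, Nat.mod_eq_of_lt (by omega), Nat.mod_eq_of_lt hl0d] at this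
      omega
    obtain ⟨J0, hJ0⟩ := hdvd
    rw [mul_comm] at hJ0
    have hJpos : 0 < J0 := by
      rcases Nat.eq_zero_or_pos J0 with h | h
      · rw [h, zero_mul] at hJ0; omega
      · exact h
    have hJT : J0 ∈ T := by
      rw [hTm]
      refine ⟨?_, hJpos, ?_⟩
      · have : J0 * 1 ≤ J0 * r ^ l0 := Nat.mul_le_mul_left _ (Nat.one_le_pow _ _ (by omega))
        omega
      · intro b hb
        have h1 := hdig (b + l0) (by rw [hJ0, digit_shift hr]; exact hb)
        rw [← Nat.modEq_zero_iff_dvd]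
        refine Nat.ModEq.add_right_cancel' l0 ?_
        simpa using h1
    have huniq : ∀ l, l < d → ∀ J ∈ T, j = J * r ^ l → l = l0 := by
      intro l hl J hJ e
      obtain ⟨h1, h2, h3⟩ := (hTm J).1 hJ
      have h4 := h3 _ (topdigit hr h2)
      obtain ⟨c, hc⟩ := h4
      rw [hl0, e, log_shift hr h2, hc, Nat.mul_add_mod, Nat.mod_eq_of_lt hl]
    rw [Finset.sum_eq_single l0, Finset.sum_eq_single J0]
    · rw [if_pos hJ0, ← hJ0]
    · intro J hJ hne
      rw [if_neg]
      intro e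
      apply hne
      rw [hJ0] at e
      exact (Nat.eq_of_mul_eq_mul_right (by positivity) e).symm
    · intro hh; exact absurd hJT hh
    · intro l hl hne
      refine Finset.sum_eq_zero fun J hJ => ?_
      rw [if_neg]
      intro e
      exact hne (huniq l (Finset.mem_range.1 hl) J hJ e)
    · intro hh; exact absurd (Finset.mem_range.2 hl0d) hh
  · have hQ : 1 < r ^ d := Nat.one_lt_pow hd.ne' hr
    have : (∑ J ∈ T, C (g.coeff J / M.coeff (r ^ 0)) * X ^ J).natDegree ≤
        (r ^ N - 1) / (r ^ d - 1) := by
      refine natDegree_sum_le_of_forall_le _ _ fun J hJ => ?_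
      obtain ⟨h1, h2, h3⟩ := (hTm J).1 hJ
      by_cases hJ0 : g.coeff J = 0
      · rw [hJ0]; simp
      refine (natDegree_C_mul_X_pow_le _ _).trans ?_
      rw [Nat.le_div_iff_mul_le (by omega)]
      obtain ⟨w, hw⟩ := S.hdN
      have h4 : r ^ N = (r ^ d) ^ w := by rw [hw, pow_mul]
      have := deg_bound hr hd w J (fun b hb => ⟨h3 b hb, (S.P1 hJ0 hb).2.2⟩) (by rw [← h4]; exact h1)
      rw [← h4] at this
      omega
    exact (Nat.mul_le_mul_right _ this).trans (Nat.div_mul_le_self _ _)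

end Setup
end key

lemma mvsp_arith {q D s : ℕ} (hD : 0 < D) (hs : 0 < s) :
    s = (q - 1) / D + 1 ↔ (s - 1) * D ≤ q - 1 ∧ q - 1 < s * D := by
  obtain ⟨s, rfl⟩ : ∃ e, s = e + 1 := ⟨s - 1, by omega⟩
  rw [Nat.add_sub_cancel, ← Nat.le_div_iff_mul_le hD, ← Nat.div_lt_iff_lt_mul hD]
  omega

section fin
variable {F : Type} [Field F] [Fintype F] [DecidableEq F] {r N d : ℕ}

lemma surjM {m : ℕ} (hK : (Finset.univ.filter (fun c : F => c ^ r ^ d = c)).card = r ^ d)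
    {M : F[X]} {U : Finset F} (hm : U.card = r ^ m) (hMm : M.Monic) (hM0 : 0 < M.natDegree)
    (hdeg : r ^ m * M.natDegree = r ^ d)
    (hmap : ∀ c : F, c ^ r ^ d = c → M.eval c ∈ U) :
    (Finset.univ.filter (fun c : F => c ^ r ^ d = c)).image (fun c => M.eval c) = U := by
  apply Finset.eq_of_subset_of_card_le
  · intro u hu
    obtain ⟨c, hc, rfl⟩ := Finset.mem_image.1 hu
    exact hmap c (Finset.mem_filter.1 hc).2
  · have h1 := Finset.card_le_mul_card_image (f := fun c => M.eval c)
      (Finset.univ.filter (fun c : F => c ^ r ^ d = c)) M.natDegree (by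
      intro u _
      have hne : M - C u ≠ 0 := by
        intro hh
        rw [sub_eq_zero] at hh
        rw [hh, natDegree_C] at hM0
        exact lt_irrefl _ hM0
      have h2 : ((Finset.univ.filter (fun c : F => c ^ r ^ d = c)).filter
          (fun c => M.eval c = u)) ⊆ (M - C u).roots.toFinset := by
        intro c hc
        rw [Multiset.mem_toFinset, mem_roots hne]
        simp [(Finset.mem_filter.1 hc).2]
      refine (Finset.card_le_card h2).trans ((Multiset.toFinset_card_le _).trans ?_)
      refine (card_roots' _).trans ?_
      rw [natDegree_sub_C])
    rw [hK] at h1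
    rw [hm]
    refine Nat.le_of_mul_le_mul_left (le_trans (le_of_eq ?_) h1) hM0
    rw [mul_comm, hdeg]

lemma mainr (h : FrobOK F r) (hcard : Fintype.card F = r ^ N) (hN : 0 < N) (hd : 0 < d)
    (hdN : d ∣ N) (U : Finset F) (hU : IsSubspaceOver r (↑U : Set F)) (h1 : (1 : F) ∈ U)
    (hU2 : 2 < U.card) (hdU : ∀ u ∈ U, u ^ r ^ d = u)
    (hmin : ∀ d', 0 < d' → (∀ u ∈ U, u ^ r ^ d' = u) → d ≤ d')
    (M : F[X]) (hMm : M.Monic) (hM : IsLinearized r M)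
    (hAM : (∏ u ∈ U, (X - C u)).comp M = X ^ r ^ d - X) :
    MVSPset U = {g | ∃ f ∈ MVSPset (Finset.univ.filter (fun c : F => c ^ r ^ d = c)),
          g = M.comp f} := by
  have hr := h.one_lt
  have hA := lin_prod h hcard hN U hU
  obtain ⟨m, hm⟩ := lin_natDegree hA (monic_prodU U)
  rw [natDegree_prodU] at hm
  have hQ : 1 < r ^ d := Nat.one_lt_pow hd.ne' hr
  have hdeg : r ^ m * M.natDegree = r ^ d := by
    have h1 := congrArg natDegree hAM
    rwa [natDegree_comp, natDegree_prodU, hm, FiniteField.X_pow_card_sub_X_natDegree_eq _ hQ] at h1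
  have hM0 : 0 < M.natDegree := by
    rcases Nat.eq_zero_or_pos M.natDegree with h | h
    · rw [h, mul_zero] at hdeg; omega
    · exact h
  have hK := card_fix hr hcard hN hdN
  have hev : ∀ c : F, M.eval c ∈ U ↔ c ^ r ^ d = c := by
    intro c
    have := congrArg (eval c) hAM
    rw [eval_comp] at this
    rw [← eval_prodU, this]
    simp [sub_eq_zero]
  have hsurj := surjM hK hm hMm hM0 hdeg (fun c hc => (hev c).2 hc)
  have hm1 : 1 ≤ m := by
    rcases Nat.eq_zero_or_pos m with h | h
    · rw [h] at hm; simp at hm; omega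
    · exact h
  have hmN : m ≤ N := by
    have := Finset.card_le_univ U
    rw [hm, hcard] at this
    exact (Nat.pow_le_pow_iff_right hr).1 this
  have hq : 1 < r ^ N := Nat.one_lt_pow hN.ne' hr
  set K := Finset.univ.filter (fun c : F => c ^ r ^ d = c) with hKd
  ext g
  simp only [MVSPset, IsMVSP, Set.mem_ofPred_eq]
  constructor
  · rintro ⟨⟨hg0, hg1⟩, hg2⟩
    rw [hg2, hcard, mvsp_arith hg0 (by omega), hm] at hg1
    obtain ⟨hg3, hg4⟩ := hg1
    have hgU : ∀ x, g.eval x ∈ U := by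
      intro x; rw [← hg2]; exact Finset.mem_image_of_mem _ (Finset.mem_univ x)
    have hS : Setup r N d m U M (g - C (g.eval 0)) := by
      refine ⟨h, hcard, hN, hdN, hd, hU.1, h1, hm, hm1, hmN, hA, hM, hAM, hdU, hmin, ?_, ?_, ?_, ?_⟩
      · rw [natDegree_sub_C]
        by_contra hcon
        have e1 : (r ^ m - 1) * (2 * r ^ (N - m)) ≤ r ^ N - 1 :=
          (Nat.mul_le_mul_left _ (by omega)).trans hg3
        have e2 : r ^ N = r ^ m * r ^ (N - m) := by rw [← pow_add]; congr 1; omega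
        have e3 : 2 * r ^ (N - m) ≤ r ^ m * r ^ (N - m) := Nat.mul_le_mul_right _ (by omega)
        rw [Nat.sub_mul, one_mul, show r ^ m * (2 * r ^ (N - m)) = 2 * (r ^ m * r ^ (N - m)) by ring]
          at e1
        omega
      · rw [natDegree_sub_C]
        by_contra hcon
        have e1 : 2 * (r ^ N - 1) ≤ r ^ N - 1 :=
          (Nat.mul_le_mul (by omega) (by omega)).trans hg3
        omega
      · intro x
        rw [eval_sub, eval_C, sub_eq_add_neg]
        exact hU.2.1 _ (hgU x) _ (hU.2.2.1 _ (hgU 0))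
      · rw [coeff_sub, coeff_C_zero, coeff_zero_eq_eval_zero, sub_self]
    obtain ⟨f0, hf0, hf1⟩ := hS.key hMm
    obtain ⟨c, hc, hc2⟩ := Finset.mem_image.1 (by rw [hsurj]; exact hgU 0 : g.eval 0 ∈ K.image _)
    have hcomp : g = M.comp (f0 + C c) := by
      rw [lin_add h hM, hf0, comp_C, hc2, sub_add_cancel]
    refine ⟨f0 + C c, ?_, hcomp⟩
    have hfd : (f0 + C c).natDegree = f0.natDegree := natDegree_add_C
    have hgd : g.natDegree = M.natDegree * (f0 + C c).natDegree := by
      conv_lhs => rw [hcomp, natDegree_comp]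
    rw [← hfd] at hf1
    set f := f0 + C c with hf
    have hfp : 0 < f.natDegree := by
      rcases Nat.eq_zero_or_pos f.natDegree with h | h
      · rw [h, mul_zero] at hgd; omega
      · exact h
    have hsub : valueSet f ⊆ K := by
      intro y hy
      obtain ⟨x, -, rfl⟩ := Finset.mem_image.1 hy
      rw [hKd, Finset.mem_filter, ← hev, ← eval_comp, ← hcomp]
      exact ⟨Finset.mem_univ _, hgU x⟩
    have hc1 : r ^ N ≤ f.natDegree * (valueSet f).card := by
      have := FiniteField.card_image_polynomial_eval (p := f)
        (natDegree_pos_iff_degree_pos.1 hfp)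
      rw [← hcard]; exact this
    have hVK : valueSet f = K := by
      apply Finset.eq_of_subset_of_card_le hsub
      rw [hK]
      by_contra hcon
      have e1 : f.natDegree * (valueSet f).card ≤ f.natDegree * (r ^ d - 1) :=
        Nat.mul_le_mul_left _ (by omega)
      omega
    refine ⟨⟨hfp, ?_⟩, hVK⟩
    rw [hVK, hK, hcard, mvsp_arith hfp (by omega)]
    refine ⟨by rw [mul_comm]; exact hf1, ?_⟩
    rw [hVK, hK, mul_comm] at hc1
    omega
  · rintro ⟨f, ⟨⟨hf0, hf1⟩, hf2⟩, rfl⟩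
    rw [hf2, hcard, hK, mvsp_arith hf0 (by omega)] at hf1
    obtain ⟨hf3, hf4⟩ := hf1
    have hV : valueSet (M.comp f) = U := by
      rw [← hsurj, ← hf2]
      simp only [valueSet, Finset.image_image, Function.comp_def, eval_comp]
    have hD : (M.comp f).natDegree = M.natDegree * f.natDegree := natDegree_comp
    have hDp : 0 < (M.comp f).natDegree := by rw [hD]; positivity
    refine ⟨⟨hDp, ?_⟩, hV⟩
    rw [hV, hcard, mvsp_arith hDp (by omega), hm, hD, ← mul_assoc, ← mul_assoc, hdeg]
    refine ⟨le_trans ?_ hf3, hf4⟩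
    refine Nat.mul_le_mul_right _ ?_
    rw [Nat.sub_mul, hdeg]
    omega
end fin

theorem stmt_2 (p n k d : ℕ) (hp : p.Prime) (hn : 0 < n) (hk : k ∣ n)
    (F : Type) [Field F] [Fintype F] [DecidableEq F]
    (hcard : Fintype.card F = p ^ n)
    (U : Finset F) (hU : IsSubspaceOver (p ^ k) (↑U : Set F))
    (h1 : (1 : F) ∈ U) (hU2 : 2 < U.card)
    (hd : 0 < d) (hdU : ∀ u ∈ U, u ^ p ^ (d * k) = u)
    (hdmin : ∀ d', 0 < d' → (∀ u ∈ U, u ^ p ^ (d' * k) = u) → d ≤ d') :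
    (d * k ∣ n) ∧
    (∃ M : F[X], M.Monic ∧ IsLinearized (p ^ k) M ∧
      (∏ u ∈ U, (X - C u)).comp M = X ^ p ^ (d * k) - X ∧
      M.comp (∏ u ∈ U, (X - C u)) = X ^ p ^ (d * k) - X) ∧
    (∀ M : F[X], M.Monic → IsLinearized (p ^ k) M →
      (∏ u ∈ U, (X - C u)).comp M = X ^ p ^ (d * k) - X →
      M.comp (∏ u ∈ U, (X - C u)) = X ^ p ^ (d * k) - X →
      MVSPset U =
        {g | ∃ f ∈ MVSPset (Finset.univ.filter (fun c : F => c ^ p ^ (d * k) = c)),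
          g = M.comp f}) := by
  have hpk : ∀ e, p ^ (e * k) = (p ^ k) ^ e := fun e => by rw [mul_comm, pow_mul]
  simp only [hpk] at hdU hdmin ⊢
  obtain ⟨N, rfl⟩ := hk
  have hk0 : 0 < k := Nat.pos_of_mul_pos_right hn
  have hN : 0 < N := Nat.pos_of_mul_pos_left hn
  have hfact := Fact.mk hp
  have hchar : CharP F p := charP_of_card_eq_prime_pow hcard
  have h : FrobOK F (p ^ k) := ⟨p, k, hp, hchar, hk0, rfl⟩
  rw [pow_mul] at hcard
  generalize hrr : p ^ k = r at *
  have hiter : ∀ (u : F) (i : ℕ), (fun x : F => x ^ r)^[i] u = u ^ r ^ i := by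
    intro u i
    induction i with
    | zero => simp
    | succ i ih => rw [Function.iterate_succ_apply', ih, pow_succ, pow_mul]
  have hdN : d ∣ N := by
    have hg : d ≤ Nat.gcd d N := by
      refine hdmin _ (Nat.gcd_pos_of_pos_left _ hd) fun u hu => ?_
      have e1 : Function.IsPeriodicPt (fun x : F => x ^ r) d u := by
        rw [Function.IsPeriodicPt, Function.IsFixedPt, hiter]; exact hdU u hu
      have e2 : Function.IsPeriodicPt (fun x : F => x ^ r) N u := by
        rw [Function.IsPeriodicPt, Function.IsFixedPt, hiter, ← hcard]
        exact FiniteField.pow_card u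
      have e3 := e1.gcd e2
      rw [Function.IsPeriodicPt, Function.IsFixedPt, hiter] at e3
      exact e3
    have := Nat.gcd_le_left N hd
    have e : Nat.gcd d N = d := le_antisymm this hg
    exact Nat.gcd_eq_left_iff_dvd.1 e
  refine ⟨?_, part2 h hcard hN hdN U hU hdU, ?_⟩
  · rw [mul_comm k N]; exact Nat.mul_dvd_mul_right hdN k
  · intro M hMm hM hAM _
    exact mainr h hcard hN hd hdN U hU h1 hU2 hdU hdmin M hMm hM hAM
end

section
/- Let p be a prime, n ≥ 1, q = p^n, k a divisor of n, v > 1 a divisor of p^k − 1, and let U = {c ∈ 𝔽_q : c^{p^{mk}} = c} be the subfield 𝔽_{p^{mk}} of 𝔽_q (so U is an 𝔽_{p^k}-subspace of dimension m with 1 ∈ U), and assume #U^v > 2. Let e be the smallest positive integer such that s^{p^e} = s for all s ∈ U^v, and set t = v·(p^e − 1)/(p^{mk} − 1) (a positive integer). Then every F ∈ 𝒫(U^v, q) that is not of the form f^t with f ∈ 𝒫(𝔽_{p^e}, q) satisfies: t > 1, U^v is not the underlying set of any subfield of 𝔽_q, and deg F ≥ (√(p^n) + 1)·p^e, as an inequality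 of real numbers. -/
open Polynomial

set_option linter.unusedSectionVars false
set_option linter.unusedVariables false


section helpers
variable {F : Type} [Field F] [Fintype F] [DecidableEq F]

lemma aux_pth_root (p : ℕ) [Fact p.Prime] [CharP F p] {f : F[X]} (hf : derivative f = 0) :
    ∃ g : F[X], f = g ^ p := by
  refine ⟨map ((frobeniusEquiv F p).symm : F →+* F) (contract p f), ?_⟩
  rw [← map_frobenius_expand, ← map_expand, map_map]
  have : (frobenius F p).comp ((frobeniusEquiv F p).symm : F →+* F) = RingHom.id F := by
    ext x
    simp
  rw [this, map_id, expand_contract p hf (Fact.out : p.Prime).ne_zero]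

lemma aux_root_elt (p : ℕ) [Fact p.Prime] [CharP F p] (i : ℕ) (c : F) : ∃ z : F, z ^ p ^ i = c := by
  induction i generalizing c with
  | zero => exact ⟨c, by simp⟩
  | succ i ih =>
    obtain ⟨z, hz⟩ := ih c
    obtain ⟨w, hw⟩ := (frobeniusEquiv F p).surjective z
    refine ⟨w, ?_⟩
    rw [frobeniusEquiv_apply, frobenius_def] at hw
    rw [pow_succ', pow_mul, hw, hz]

lemma aux_prod : ∏ a : F, (X - C a) = (X ^ Fintype.card F - X : F[X]) := by
  have h := FiniteField.roots_X_pow_card_sub_X F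
  have hm : (X ^ Fintype.card F - X : F[X]).Monic := by
    apply monic_X_pow_sub
    rw [degree_X]
    exact_mod_cast Fintype.one_lt_card
  have hd : (X ^ Fintype.card F - X : F[X]).natDegree = Fintype.card F :=
    FiniteField.X_pow_card_sub_X_natDegree_eq F Fintype.one_lt_card
  have h2 := prod_multiset_X_sub_C_of_monic_of_roots_card_eq hm (by rw [h, hd]; rfl)
  rw [h] at h2
  exact h2

noncomputable def auxL (f : F[X]) : F[X] := ∏ a ∈ Finset.univ.filter (fun a => f.eval a = 0), (X - C a)

lemma auxL_dvd (f : F[X]) : auxL f ∣ f := by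
  apply Finset.prod_dvd_of_coprime
  · intro a _ b _ hab
    exact isCoprime_X_sub_C_of_isUnit_sub (sub_ne_zero.mpr hab).isUnit
  · intro a ha
    simp only [Finset.mem_filter] at ha
    exact dvd_iff_isRoot.mpr ha.2

lemma auxL_monic (f : F[X]) : (auxL f).Monic := monic_prod_X_sub_C _ _

lemma auxL_natDegree (f : F[X]) :
    (auxL f).natDegree = (Finset.univ.filter (fun a => f.eval a = 0)).card := by
  unfold auxL
  rw [natDegree_prod_of_monic _ _ (fun a _ => monic_X_sub_C a)]
  simp

lemma auxL_sep (f : F[X]) : IsCoprime (auxL f) (derivative (auxL f)) := by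
  have : (auxL f).Separable := by
    unfold auxL
    apply separable_prod_X_sub_C_iff'.mpr
    intro x _ y _ h
    exact h
  exact this

lemma aux_struct (f : F[X]) (r : ℕ) (hr : 2 ≤ r) (hd : 0 < f.natDegree)
    (hval : ∀ a, f.eval a = 0 ∨ f.eval a ^ r = 1)
    (hdeg : r * f.natDegree + 1 ≤ Fintype.card F) (hq : Fintype.card F ≤ (r + 1) * f.natDegree) :
    f ^ r * auxL f = auxL f + derivative (auxL f) * (X ^ Fintype.card F - X) ∧
      derivative (derivative (auxL f)) = 0 := by
  set q := Fintype.card F with hqdef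
  set L := auxL f with hL
  set M : F[X] := ∏ a ∈ Finset.univ.filter (fun a => ¬ f.eval a = 0), (X - C a) with hM
  have hf0 : f ≠ 0 := by rintro rfl; simp at hd
  have hLM : L * M = X ^ q - X := by
    rw [← aux_prod]
    exact Finset.prod_filter_mul_prod_filter_not _ _ _
  have hdq : derivative (X ^ q - X : F[X]) = -1 := by
    rw [derivative_sub, derivative_X_pow, hqdef]
    simp
  have hq1 : 1 < q := Fintype.one_lt_card
  have hqmonic : (X ^ q - X : F[X]).Monic := by
    apply monic_X_pow_sub
    rw [degree_X]; exact_mod_cast hq1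
  have hqd : (X ^ q - X : F[X]).natDegree = q :=
    FiniteField.X_pow_card_sub_X_natDegree_eq F hq1
  -- step 1
  have hdvd : (X ^ q - X : F[X]) ∣ f ^ (r + 1) - f := by
    rw [← aux_prod]
    apply Finset.prod_dvd_of_coprime
    · intro a _ b _ hab
      exact isCoprime_X_sub_C_of_isUnit_sub (sub_ne_zero.mpr hab).isUnit
    · intro a _
      rw [dvd_iff_isRoot, IsRoot.def]
      rcases hval a with h | h
      · simp [h]
      · simp [pow_succ, h]
  obtain ⟨A, hA⟩ := hdvd
  have hAdeg : A.natDegree ≤ f.natDegree - 1 := by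
    by_cases hA0 : A = 0
    · simp [hA0]
    have h1 : (f ^ (r + 1) - f).natDegree ≤ (r + 1) * f.natDegree := by
      refine (natDegree_sub_le _ _).trans ?_
      rw [natDegree_pow]
      apply max_le le_rfl
      nlinarith
    rw [hA, hqmonic.natDegree_mul' hA0, hqd] at h1
    have : (r+1) * f.natDegree = r * f.natDegree + f.natDegree := by ring
    omega
  have hlle : L.natDegree ≤ f.natDegree := natDegree_le_of_dvd (auxL_dvd f) hf0
  have hAeq : A + (r : F[X]) * derivative f = 0 := by
    apply eq_zero_of_natDegree_lt_card_of_eval_eq_zero' _ (Finset.univ.filter (fun a => ¬ f.eval a = 0))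
    · intro a ha
      simp only [Finset.mem_filter, Finset.mem_univ, true_and] at ha
      have h1 := (hval a).resolve_left ha
      have h2 := congrArg (fun g => eval a (derivative g)) hA
      simp only [derivative_mul, hdq, derivative_sub, derivative_pow] at h2
      simp [h1, hqdef, FiniteField.pow_card] at h2
      simp only [eval_add, eval_mul, eval_natCast]
      linear_combination h2
    · have h3 : (Finset.univ.filter (fun a => f.eval a = 0)).card + (Finset.univ.filter (fun a => ¬ f.eval a = 0)).card = q := by
        rw [Finset.card_filter_add_card_filter_not]; rfl
      have h4 := auxL_natDegree f
      rw [← hL] at h4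
      have h5 : (A + (r : F[X]) * derivative f).natDegree ≤ f.natDegree - 1 := by
        refine (natDegree_add_le _ _).trans (max_le hAdeg ?_)
        refine natDegree_mul_le.trans ?_
        rw [natDegree_natCast, zero_add]
        exact natDegree_derivative_le f
      have : 2 * f.natDegree ≤ r * f.natDegree := Nat.mul_le_mul_right _ hr
      omega
  have heq : f ^ (r + 1) - f = - (r : F[X]) * (X ^ q - X) * derivative f := by
    rw [hA]; linear_combination (X ^ q - X) * hAeq
  have hM' : derivative L * M + L * derivative M = -1 := by
    rw [← derivative_mul, hLM, hdq]
  set Y := f * derivative L + (r : F[X]) * derivative f * L with hY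
  have hMY : M * Y = - (f * (L * derivative M + f ^ r)) := by
    rw [← hLM] at heq
    rw [hY]; linear_combination f * hM' + heq
  have hcop : IsCoprime M f := by
    apply IsCoprime.prod_left
    intro a ha
    simp only [Finset.mem_filter, Finset.mem_univ, true_and] at ha
    have : Irreducible (X - C a) := irreducible_X_sub_C a
    rw [this.coprime_iff_not_dvd, dvd_iff_isRoot]
    exact ha
  have hMm : M.Monic := monic_prod_X_sub_C _ _
  have hLm : L.Monic := auxL_monic f
  have hdvM : M ∣ L * derivative M + f ^ r := by
    apply hcop.dvd_of_dvd_mul_left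
    refine ⟨-Y, ?_⟩
    linear_combination hMY
  obtain ⟨Z, hZ⟩ := hdvM
  have hYZ : Y = - (f * Z) := by
    apply mul_left_cancel₀ hMm.ne_zero
    rw [hMY, hZ]; ring
  have hLZ : L ∣ Z := by
    have hc : IsCoprime L M := IsCoprime.symm (hcop.of_isCoprime_of_dvd_right (auxL_dvd f))
    apply hc.dvd_of_dvd_mul_left
    rw [← hZ]
    exact dvd_add (dvd_mul_right _ _) ((auxL_dvd f).trans (dvd_pow_self f (by omega)))
  have hZ0 : Z = 0 := by
    by_contra hZ0
    have hYd : Y.natDegree + 1 ≤ f.natDegree + L.natDegree := by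
      have hl : L.natDegree ≤ Z.natDegree := natDegree_le_of_dvd hLZ hZ0
      have h1 : (f * derivative L).natDegree ≤ f.natDegree + (L.natDegree - 1) :=
        natDegree_mul_le.trans (Nat.add_le_add_left (natDegree_derivative_le L) _)
      have h2 : ((r : F[X]) * derivative f * L).natDegree ≤ (f.natDegree - 1) + L.natDegree := by
        refine natDegree_mul_le.trans (Nat.add_le_add_right ?_ _)
        refine natDegree_mul_le.trans ?_
        rw [natDegree_natCast, zero_add]
        exact natDegree_derivative_le f
      by_cases hl0 : L.natDegree = 0
      · have hd0 : derivative L = 0 := by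
          rw [eq_C_of_natDegree_eq_zero hl0]; simp
        rw [hY, hd0, mul_zero, zero_add]
        omega
      · have := (natDegree_add_le (f * derivative L) ((r : F[X]) * derivative f * L))
        rw [← hY] at this
        omega
    have h3 : Y.natDegree = f.natDegree + Z.natDegree := by
      rw [hYZ, natDegree_neg, natDegree_mul hf0 hZ0]
    have hl : L.natDegree ≤ Z.natDegree := natDegree_le_of_dvd hLZ hZ0
    omega
  rw [hZ0, mul_zero] at hZ
  rw [hZ0, mul_zero, neg_zero] at hYZ
  have hE : f ^ r * L = L + derivative L * (X ^ q - X) := by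
    rw [← hLM]; linear_combination L * hZ - L * hM'
  refine ⟨hE, ?_⟩
  have hE' := congrArg derivative hE
  have h6 : derivative (f ^ r * L) = f ^ (r - 1) * Y := by
    obtain ⟨s, rfl⟩ : ∃ s, r = s + 1 := ⟨r - 1, by omega⟩
    rw [derivative_mul, derivative_pow, hY]
    simp
    ring
  rw [h6, hYZ, mul_zero, derivative_add, derivative_mul, hdq] at hE'
  have h7 : derivative (derivative L) * (X ^ q - X) = 0 := by linear_combination -hE'
  exact (mul_eq_zero.mp h7).resolve_right hqmonic.ne_zero

end helpers
section helpers2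
variable {F : Type} [Field F] [Fintype F] [DecidableEq F]

lemma aux_rm_pow (g : F[X]) (c : F) (k : ℕ) :
    rootMultiplicity c (g ^ k) = k * rootMultiplicity c g := by
  rw [← count_roots, ← count_roots, roots_pow, Multiset.count_nsmul]

lemma aux_degs {L a b : F[X]} {P : ℕ} (hP : 2 ≤ P) (hL : L = a ^ P + X * b ^ P) (hb : b ≠ 0) :
    P * a.natDegree ≤ L.natDegree ∧ P * b.natDegree + 1 ≤ L.natDegree ∧
      (L.natDegree = P * a.natDegree ∨ L.natDegree = P * b.natDegree + 1) := by
  have h1 : (a ^ P).natDegree = P * a.natDegree := natDegree_pow _ _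
  have h2 : (X * b ^ P).natDegree = P * b.natDegree + 1 := by
    rw [natDegree_X_mul (pow_ne_zero _ hb), natDegree_pow]
  have hne : P * a.natDegree ≠ P * b.natDegree + 1 := by
    intro h
    have h3 : P ∣ P * b.natDegree + 1 := ⟨_, h.symm⟩
    rw [Nat.dvd_add_right (dvd_mul_right _ _)] at h3
    have := Nat.le_of_dvd one_pos h3
    omega
  rcases lt_or_gt_of_ne hne with h | h
  · have : L.natDegree = P * b.natDegree + 1 := by
      rw [hL, natDegree_add_eq_right_of_natDegree_lt (by rw [h1, h2]; exact h), h2]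
    omega
  · have : L.natDegree = P * a.natDegree := by
      rw [hL, natDegree_add_eq_left_of_natDegree_lt (by rw [h1, h2]; exact h), h1]
    omega

lemma aux_der_pow (p : ℕ) [Fact p.Prime] [CharP F p] (g : F[X]) (i : ℕ) (hi : 1 ≤ i) :
    derivative (g ^ p ^ i) = 0 := by
  rw [derivative_pow]
  have : ((p ^ i : ℕ) : F) = 0 := by
    rw [CharP.cast_eq_zero_iff F p]
    exact dvd_pow_self p (by omega)
  rw [this]; simp

lemma aux_coprime (p : ℕ) [Fact p.Prime] [CharP F p] {L a b : F[X]} {i : ℕ} (hi : 1 ≤ i)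
    (hsep : IsCoprime L (derivative L)) (hL : L = a ^ p ^ i + X * b ^ p ^ i) : IsCoprime a b := by
  have hd : derivative L = b ^ p ^ i := by
    rw [hL, derivative_add, derivative_mul, aux_der_pow p a i hi, aux_der_pow p b i hi]
    simp
  rw [hd, hL] at hsep
  have hP : 0 < p ^ i := pow_pos (Fact.out : p.Prime).pos _
  have h2 : IsCoprime (a ^ p ^ i) (b ^ p ^ i) := IsCoprime.of_add_mul_right_left hsep
  exact (IsCoprime.pow_iff hP hP).mp h2

lemma aux_b_ne (p : ℕ) [Fact p.Prime] [CharP F p] {L a b : F[X]} {i : ℕ} (hi : 1 ≤ i)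
    (hsep : IsCoprime L (derivative L)) (hl : 0 < L.natDegree)
    (hL : L = a ^ p ^ i + X * b ^ p ^ i) : b ≠ 0 := by
  rintro rfl
  have hP : 0 < p ^ i := pow_pos (Fact.out : p.Prime).pos _
  have hc := aux_coprime p hi hsep hL
  rw [isCoprime_zero_right] at hc
  have hu : IsUnit L := by rw [hL, zero_pow hP.ne', mul_zero, add_zero]; exact hc.pow _
  have := natDegree_eq_zero_of_isUnit hu
  omega

lemma aux_W_zero (a b : F[X]) (hc : IsCoprime a b)
    (hW : derivative a * b - a * derivative b = 0) : derivative a = 0 ∧ derivative b = 0 := by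
  have key : ∀ u v : F[X], IsCoprime u v → derivative u * v - u * derivative v = 0 →
      derivative v = 0 := by
    intro u v huv h
    have h1 : v ∣ u * derivative v := ⟨derivative u, by linear_combination -h⟩
    have h2 : v ∣ derivative v := huv.symm.dvd_of_dvd_mul_left h1
    by_contra h3
    have h4 := natDegree_le_of_dvd h2 h3
    by_cases h5 : v.natDegree = 0
    · apply h3; rw [eq_C_of_natDegree_eq_zero h5]; simp
    · have := natDegree_derivative_lt h5
      omega
  exact ⟨key b a hc.symm (by linear_combination -hW), key a b hc hW⟩

lemma aux_W_deg (a b : F[X]) (hW : derivative a * b - a * derivative b ≠ 0) :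
    (derivative a * b - a * derivative b).natDegree + 1 ≤ a.natDegree + b.natDegree := by
  have z : ∀ u : F[X], u.natDegree = 0 → derivative u = 0 := by
    intro u hu; rw [eq_C_of_natDegree_eq_zero hu]; simp
  have h1 : (derivative a * b).natDegree ≤ (a.natDegree - 1) + b.natDegree :=
    natDegree_mul_le.trans (Nat.add_le_add_right (natDegree_derivative_le a) _)
  have h2 : (a * derivative b).natDegree ≤ a.natDegree + (b.natDegree - 1) :=
    natDegree_mul_le.trans (Nat.add_le_add_left (natDegree_derivative_le b) _)
  have h3 := natDegree_sub_le (derivative a * b) (a * derivative b)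
  by_cases ha : a.natDegree = 0
  · by_cases hb : b.natDegree = 0
    · exfalso; apply hW; rw [z a ha, z b hb]; simp
    · rw [z a ha, zero_mul, zero_sub, natDegree_neg]; omega
  · by_cases hb : b.natDegree = 0
    · rw [z b hb, mul_zero, sub_zero]; omega
    · omega

lemma aux_base (p n : ℕ) [Fact p.Prime] [CharP F p] (hn : 1 ≤ n) (L E : F[X])
    (hE : E = L + derivative L * (X ^ p ^ n - X)) (h2 : derivative (derivative L) = 0) :
    ∃ a b : F[X], L = a ^ p ^ 1 + X * b ^ p ^ 1 ∧ E = (a + X ^ p ^ (n - 1) * b) ^ p ^ 1 := by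
  obtain ⟨b, hb⟩ := aux_pth_root p h2
  obtain ⟨a, ha⟩ := aux_pth_root p (f := L - X * derivative L) (by simp [h2])
  refine ⟨a, b, ?_, ?_⟩
  · rw [pow_one, ← ha, ← hb]; ring
  · rw [pow_one, add_pow_char, mul_pow, ← ha, ← hb, ← pow_mul, ← pow_succ, Nat.sub_add_cancel hn, hE]
    ring

lemma aux_step (p n i : ℕ) [Fact p.Prime] [CharP F p] (hn : i < n) (L E a b : F[X])
    (hL : L = a ^ p ^ i + X * b ^ p ^ i) (hE : E = (a + X ^ p ^ (n - i) * b) ^ p ^ i)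
    (ha : derivative a = 0) (hb : derivative b = 0) :
    ∃ a b : F[X], L = a ^ p ^ (i + 1) + X * b ^ p ^ (i + 1) ∧
      E = (a + X ^ p ^ (n - (i + 1)) * b) ^ p ^ (i + 1) := by
  obtain ⟨a1, rfl⟩ := aux_pth_root p ha
  obtain ⟨b1, rfl⟩ := aux_pth_root p hb
  refine ⟨a1, b1, ?_, ?_⟩
  · rw [hL, ← pow_mul, ← pow_mul, ← pow_succ']
  · have h1 : a1 ^ p + X ^ p ^ (n - i) * b1 ^ p = (a1 + X ^ p ^ (n - (i + 1)) * b1) ^ p := by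
      rw [add_pow_char, mul_pow, ← pow_mul X, ← pow_succ]
      congr 4
      omega
    rw [hE, h1, ← pow_mul, ← pow_succ']

lemma aux_W0 (p n i r : ℕ) [Fact p.Prime] [CharP F p] (hi : 1 ≤ i) (hn : i < n) (hr : 2 ≤ r)
    (hri : ¬ r ∣ p ^ i - 1) (f a b : F[X]) (hf : f ≠ 0) (hl : 0 < (auxL f).natDegree)
    (hL : auxL f = a ^ p ^ i + X * b ^ p ^ i)
    (hE : f ^ r * auxL f = (a + X ^ p ^ (n - i) * b) ^ p ^ i) :
    derivative a * b - a * derivative b = 0 := by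
  by_contra hW
  set D := a + X ^ p ^ (n - i) * b with hD
  have hP2 : 2 ≤ p ^ i := (Fact.out : p.Prime).two_le.trans (Nat.le_self_pow (by omega) p)
  have hb0 := aux_b_ne p hi (auxL_sep f) hl hL
  have hne : f ^ r * auxL f ≠ 0 := mul_ne_zero (pow_ne_zero _ hf) (auxL_monic f).ne_zero
  have hD0 : D ≠ 0 := by
    intro h
    rw [h, zero_pow (by omega)] at hE
    exact hne hE
  have hDW : derivative a * b - a * derivative b = derivative D * b - D * derivative b := by
    rw [hD, derivative_add, derivative_mul, aux_der_pow p X (n - i) (by omega)]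
    ring
  have hdv : auxL f ∣ derivative a * b - a * derivative b := by
    unfold auxL
    apply Finset.prod_dvd_of_coprime
    · intro a _ b _ hab
      exact isCoprime_X_sub_C_of_isUnit_sub (sub_ne_zero.mpr hab).isUnit
    · intro c hc
      have hcL : IsRoot (auxL f) c := by
        rw [← dvd_iff_isRoot]
        exact Finset.dvd_prod_of_mem (fun c => X - C c) hc
      have h1 : rootMultiplicity c (auxL f) = 1 := by
        apply le_antisymm
        · exact rootMultiplicity_le_one_of_separable (auxL_sep f) c
        · exact (rootMultiplicity_pos (auxL_monic f).ne_zero).mpr hcL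
      have h2 := congrArg (rootMultiplicity c) hE
      rw [rootMultiplicity_mul hne, aux_rm_pow, aux_rm_pow, h1] at h2
      have h3 : 2 ≤ rootMultiplicity c D := by
        by_contra h
        have : rootMultiplicity c D = 0 ∨ rootMultiplicity c D = 1 := by omega
        rcases this with h | h
        · rw [h] at h2; omega
        · rw [h] at h2
          apply hri
          exact ⟨rootMultiplicity c f, by omega⟩
      have h4 : (X - C c) ^ 2 ∣ D := (le_rootMultiplicity_iff hD0).mp h3
      obtain ⟨D1, hD1⟩ := h4
      rw [hDW]
      refine ⟨(2 * D1 + (X - C c) * derivative D1) * b - (X - C c) * D1 * derivative b, ?_⟩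
      have : derivative D = (X - C c) * (2 * D1 + (X - C c) * derivative D1) := by
        rw [hD1, derivative_mul, derivative_X_sub_C_pow]
        simp only [map_ofNat, Nat.cast_ofNat, pow_one, Nat.add_one_sub_one]
        ring
      rw [this, hD1]; ring
  have h5 := natDegree_le_of_dvd hdv hW
  have h6 := aux_W_deg a b hW
  obtain ⟨h7, h8, -⟩ := aux_degs hP2 hL hb0
  nlinarith

lemma aux_iter (p n i r e : ℕ) [Fact p.Prime] [CharP F p] (hi : 1 ≤ i) (hie : i ≤ e) (hn : e ≤ n) (hr : 2 ≤ r)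
    (hri : ∀ j, i ≤ j → j < e → ¬ r ∣ p ^ j - 1) (f : F[X]) (hf : f ≠ 0) (hl : 0 < (auxL f).natDegree)
    (h : ∃ a b : F[X], auxL f = a ^ p ^ i + X * b ^ p ^ i ∧
      f ^ r * auxL f = (a + X ^ p ^ (n - i) * b) ^ p ^ i) :
    ∃ a b : F[X], auxL f = a ^ p ^ e + X * b ^ p ^ e ∧
      f ^ r * auxL f = (a + X ^ p ^ (n - e) * b) ^ p ^ e := by
  induction e, hie using Nat.le_induction with
  | base => exact h
  | succ e hie ih =>
    obtain ⟨a, b, h1, h2⟩ := ih (by omega) (fun j h1 h2 => hri j h1 (by omega))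
    have hW := aux_W0 p n e r (by omega) (by omega) hr (hri e hie (by omega)) f a b hf hl h1 h2
    obtain ⟨ha, hb⟩ := aux_W_zero a b (aux_coprime p (by omega) (auxL_sep f) h1) hW
    exact aux_step p n e (by omega) _ _ a b h1 h2 ha hb
end helpers2

section helpers3
variable {F : Type} [Field F] [Fintype F] [DecidableEq F]

lemma aux_seq (A B : ℕ → F) (m : ℕ) (hm : 2 ≤ m)
    (h1 : ∀ j k, j + 1 ≤ m → k + 1 ≤ m → A (j+1) * A k = A (k+1) * A j)
    (h2 : ∀ j k, j + 1 ≤ m → k + 1 ≤ m → B (j+1) * B k = B (k+1) * B j)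
    (h3 : ∀ j k, j + 1 ≤ m → k + 1 ≤ m →
      A (j+1) * B k + B (j+1) * A k = A (k+1) * B j + B (k+1) * A j) :
    ∃ u w : F, (u ≠ 0 ∨ w ≠ 0) ∧ ∀ i ≤ m, u * A i = w * B i := by
  have adj : ∀ j, j + 1 ≤ m → A j * B (j+1) = A (j+1) * B j := by
    intro j hj
    apply sub_eq_zero.mp
    apply pow_eq_zero_iff (two_ne_zero) |>.mp
    by_cases h : j + 2 ≤ m
    · have e1 := h1 j (j+1) hj h
      have e2 := h2 j (j+1) hj h
      have e3 := h3 j (j+1) hj h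
      rw [show j + 1 + 1 = j + 2 from rfl] at *
      linear_combination (A j)* (A j) * e2 + (B j) * (B j) * e1 - (A j) * (B j) * e3
    · obtain ⟨i, rfl⟩ : ∃ i, j = i + 1 := ⟨j - 1, by omega⟩
      have e1 := h1 i (i+1) (by omega) hj
      have e2 := h2 i (i+1) (by omega) hj
      have e3 := h3 i (i+1) (by omega) hj
      rw [show i + 1 + 1 = i + 2 from rfl] at *
      linear_combination (A (i+2))* (A (i+2)) * e2 + (B (i+2)) * (B (i+2)) * e1 - (A (i+2)) * (B (i+2)) * e3
  by_cases hint : ∃ j, 1 ≤ j ∧ j + 1 ≤ m ∧ (A j ≠ 0 ∨ B j ≠ 0)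
  · obtain ⟨j0, hj1, hj2, hj3⟩ := hint
    have up : ∀ i, j0 ≤ i → i ≤ m → (B j0 * A i = A j0 * B i ∧ (A i ≠ 0 ∨ B i ≠ 0)) := by
      intro i hi
      induction i, hi using Nat.le_induction with
      | base => intro _; exact ⟨by ring, hj3⟩
      | succ i hi ih =>
        intro him
        obtain ⟨hc, hne⟩ := ih (by omega)
        obtain ⟨s, rfl⟩ : ∃ s, i = s + 1 := ⟨i - 1, by omega⟩
        have e1 := h1 s (s+1) (by omega) him
        have e2 := h2 s (s+1) (by omega) him
        have ea := adj (s+1) him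
        constructor
        · rcases hne with h | h
          · apply mul_left_cancel₀ h
            linear_combination A (s+1+1) * hc - A j0 * ea
          · apply mul_left_cancel₀ h
            linear_combination B (s+1+1) * hc - B j0 * ea
        · by_contra hcon
          push Not at hcon
          rw [hcon.1] at e1
          rw [hcon.2] at e2
          rcases hne with h | h
          · exact h (by simpa using e1)
          · exact h (by simpa using e2)
    have down : ∀ s, ∀ i, i + s = j0 → (B j0 * A i = A j0 * B i ∧ (A i ≠ 0 ∨ B i ≠ 0)) := by
      intro s
      induction s with
      | zero => intro i hi; obtain rfl : i = j0 := by omega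
                exact ⟨by ring, hj3⟩
      | succ s ih =>
        intro i hi
        obtain ⟨hc, hne⟩ := ih (i+1) (by omega)
        have e1 := h1 i (i+1) (by omega) (by omega)
        have e2 := h2 i (i+1) (by omega) (by omega)
        have ea := adj i (by omega)
        constructor
        · rcases hne with h | h
          · apply mul_left_cancel₀ h
            linear_combination A i * hc + A j0 * ea
          · apply mul_left_cancel₀ h
            linear_combination B i * hc + B j0 * ea
        · by_contra hcon
          push Not at hcon
          rw [hcon.1] at e1
          rw [hcon.2] at e2
          rcases hne with h | h
          · exact h (by simpa using e1)
          · exact h (by simpa using e2)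
    refine ⟨B j0, A j0, hj3.symm, ?_⟩
    intro i hi
    rcases le_total j0 i with h | h
    · exact (up i h hi).1
    · exact (down (j0 - i) i (by omega)).1
  · push Not at hint
    have hz : ∀ i, 1 ≤ i → i + 1 ≤ m → A i = 0 ∧ B i = 0 := hint
    obtain ⟨s, rfl⟩ : ∃ s, m = s + 2 := ⟨m - 2, by omega⟩
    have z1 := hz 1 le_rfl (by omega)
    have e1 := h1 0 (s+1) (by omega) (by omega)
    have e2 := h2 0 (s+1) (by omega) (by omega)
    have e3 := h3 0 (s+1) (by omega) (by omega)
    simp only [zero_add, z1.1, z1.2, zero_mul] at e1 e2 e3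
    have hAB : A (s+1+1) * B 0 = 0 ∧ B (s+1+1) * A 0 = 0 := by
      rcases mul_eq_zero.mp e1.symm with h | h
      · rw [h] at e3 ⊢
        simp at e3 ⊢
        exact e3
      · rw [h] at e3 ⊢
        simp at e3 ⊢
        exact e3
    by_cases h0 : A 0 = 0 ∧ B 0 = 0
    · by_cases hl : A (s+2) = 0 ∧ B (s+2) = 0
      · refine ⟨1, 0, by simp, ?_⟩
        intro i hi
        rcases Nat.eq_zero_or_pos i with rfl | h
        · simp [h0]
        · by_cases hi2 : i = s + 2
          · subst hi2; simp [hl]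
          · simp [(hz i h (by omega)).1]
      · refine ⟨B (s+2), A (s+2), by tauto, ?_⟩
        intro i hi
        rcases Nat.eq_zero_or_pos i with rfl | h
        · simp [h0]
        · by_cases hi2 : i = s + 2
          · subst hi2; ring
          · simp [(hz i h (by omega)).1, (hz i h (by omega)).2]
    · refine ⟨B 0, A 0, by tauto, ?_⟩
      intro i hi
      rcases Nat.eq_zero_or_pos i with rfl | h
      · ring
      · by_cases hi2 : i = s + 2
        · subst hi2
          have a1 := hAB.1; have a2 := hAB.2
          linear_combination a1 - a2
        · simp [(hz i h (by omega)).1, (hz i h (by omega)).2]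

lemma aux_final (N G Δ : F[X]) (r t : ℕ) (hr : 2 ≤ r) (hN : N ≠ 0) (hG : G ≠ 0)
    (hGd : G.natDegree ≤ 2) (hΔd : Δ.natDegree ≤ 2) (hNd : N.natDegree ≤ 2 * t)
    (h : G * N ^ r = Δ ^ (r * t + 1)) : ∃ c : F, N = C c * Δ ^ t := by
  have hΔ : Δ ≠ 0 := by
    rintro rfl
    rw [zero_pow (by omega)] at h
    exact (mul_ne_zero hG (pow_ne_zero _ hN)) h
  obtain ⟨g, X', N', hg, hX, hN', hc⟩ : ∃ g X' N' : F[X], g ≠ 0 ∧ Δ ^ t = g * X' ∧ N = g * N' ∧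
      IsCoprime X' N' := by
    let : GCDMonoid F[X] := UniqueFactorizationMonoid.toGCDMonoid F[X]
    obtain ⟨x', y', hx, hy, hu⟩ := extract_gcd (Δ ^ t) N
    exact ⟨gcd (Δ ^ t) N, x', y', fun h0 => hN (by rw [hy, h0, zero_mul]), hx, hy, by
      rw [gcd_isUnit_iff_isRelPrime] at hu
      exact hu.isCoprime⟩
  have hX0 : X' ≠ 0 := by rintro rfl; rw [mul_zero] at hX; exact pow_ne_zero _ hΔ hX
  have hN0 : N' ≠ 0 := by rintro rfl; rw [mul_zero] at hN'; exact hN hN'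
  have key : Δ * X' ^ r = G * N' ^ r := by
    apply mul_left_cancel₀ (pow_ne_zero r hg)
    have e1 : (Δ ^ t) ^ r = (g * X') ^ r := by rw [hX]
    rw [hN', mul_pow, pow_succ, mul_comm r t, pow_mul, e1, mul_pow] at h
    linear_combination -h
  have hNdv : N' ^ r ∣ Δ := by
    have : IsCoprime (N' ^ r) (X' ^ r) := hc.symm.pow
    exact this.dvd_of_dvd_mul_right ⟨G, by rw [key]; ring⟩
  have hdeg := congrArg natDegree key
  rw [natDegree_mul hΔ (pow_ne_zero _ hX0), natDegree_mul hG (pow_ne_zero _ hN0), natDegree_pow,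
    natDegree_pow] at hdeg
  have hXdeg := congrArg natDegree hX
  rw [natDegree_pow, natDegree_mul hg hX0] at hXdeg
  have hNdeg := congrArg natDegree hN'
  rw [natDegree_mul hg hN0] at hNdeg
  by_cases hN1 : N'.natDegree = 0
  · have hX1 : X'.natDegree = 0 := by
      by_contra hX1
      rw [hN1] at hdeg
      have : 2 ≤ r * X'.natDegree := by nlinarith [Nat.pos_of_ne_zero hX1]
      have hz : Δ.natDegree = 0 := by omega
      rw [hz] at hXdeg
      omega
    rw [eq_C_of_natDegree_eq_zero hN1] at hN' hN0
    rw [eq_C_of_natDegree_eq_zero hX1] at hX hX0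
    refine ⟨N'.coeff 0 / X'.coeff 0, ?_⟩
    have hx : X'.coeff 0 ≠ 0 := by simpa using hX0
    rw [hX, hN', mul_left_comm, ← C_mul, div_mul_cancel₀ _ hx]
  · exfalso
    have h1 := natDegree_le_of_dvd hNdv hΔ
    rw [natDegree_pow] at h1
    have hn1 : 1 ≤ N'.natDegree := Nat.pos_of_ne_zero hN1
    have hr2 : r = 2 := by nlinarith
    subst hr2
    have hn2 : N'.natDegree = 1 := by omega
    have hΔ2 : Δ.natDegree = 2 := by omega
    obtain ⟨w, hw⟩ := hNdv
    have hw0 : w ≠ 0 := by rintro rfl; rw [mul_zero] at hw; exact hΔ hw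
    have hwd := congrArg natDegree hw
    rw [natDegree_mul (pow_ne_zero _ hN0) hw0, natDegree_pow, hΔ2, hn2] at hwd
    have hX1 : X'.natDegree = 0 := by
      have hwu : IsUnit w := by
        rw [eq_C_of_natDegree_eq_zero (show w.natDegree = 0 by omega)] at hw0 ⊢
        exact isUnit_C.mpr (isUnit_iff_ne_zero.mpr (by simpa using hw0))
      have hcc : IsCoprime X' (Δ ^ t) := by
        apply IsCoprime.pow_right
        rw [hw]
        exact IsCoprime.mul_right hc.pow_right (isCoprime_one_right.of_isCoprime_of_dvd_right hwu.dvd)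
      have : IsUnit X' := hcc.isUnit_of_dvd' dvd_rfl ⟨g, by rw [hX]; ring⟩
      exact natDegree_eq_zero_of_isUnit this
    rw [hΔ2] at hXdeg
    omega

end helpers3

section helpers4
variable {F : Type} [Field F] [Fintype F] [DecidableEq F]

lemma aux_decomp (f L D : F[X]) (r t R : ℕ) (hr : 1 ≤ r) (hR : R = r * t + 1)
    (hf : f ≠ 0) (hsep : IsCoprime L (derivative L))
    (h : f ^ r * L = D ^ R) : ∃ N : F[X], f = D ^ t * N ∧ D = L * N ^ r := by
  have hL0 : L ≠ 0 := by
    rintro rfl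
    simp [isCoprime_zero_left] at hsep
  have hD0 : D ≠ 0 := by
    rintro rfl
    rw [zero_pow (by omega)] at h
    exact mul_ne_zero (pow_ne_zero _ hf) hL0 h
  have hsq : Squarefree L := Polynomial.Separable.squarefree hsep
  have hLD : L ∣ D := by
    rw [← hsq.dvd_pow_iff_dvd (show R ≠ 0 by omega)]
    exact ⟨f ^ r, by rw [← h]; ring⟩
  obtain ⟨Q, hQ⟩ := hLD
  have h1 : f ^ r = (D ^ t) ^ r * Q := by
    apply mul_right_cancel₀ hL0
    rw [h, hR, pow_succ, mul_comm r t, pow_mul]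
    nth_rewrite 2 [hQ]
    ring
  have h2 : D ^ t ∣ f := by
    rw [← IsIntegrallyClosed.pow_dvd_pow_iff (show r ≠ 0 by omega)]
    exact ⟨Q, h1⟩
  obtain ⟨N, hN⟩ := h2
  refine ⟨N, hN, ?_⟩
  have h3 : Q = N ^ r := by
    apply mul_left_cancel₀ (pow_ne_zero r (pow_ne_zero t hD0))
    rw [← h1, hN, mul_pow]
  rw [← h3]; exact hQ

lemma aux_coeff_expand (u w : F[X]) (R i j : ℕ) (hR : 0 < R) (hu : u.natDegree < R) (hi : i < R) :
    (u * expand F R w).coeff (R * j + i) = u.coeff i * w.coeff j := by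
  induction w using Polynomial.induction_on' with
  | add a b ha hb => simp only [map_add, mul_add, coeff_add, ha, hb]
  | monomial k c =>
    rw [expand_monomial, coeff_monomial, ← C_mul_X_pow_eq_monomial, mul_comm (C c), ← mul_assoc,
      coeff_mul_C, coeff_mul_X_pow', mul_comm k R]
    by_cases hkj : k = j
    · subst hkj
      rw [if_pos (by omega), if_pos rfl]
      congr 2
      omega
    · rw [if_neg hkj, mul_zero]
      split_ifs with hle
      · rcases lt_or_gt_of_ne hkj with hh | hh
        · rw [coeff_eq_zero_of_natDegree_lt, zero_mul]
          have : R * (k + 1) ≤ R * j := Nat.mul_le_mul_left _ hh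
          rw [mul_add, mul_one] at this
          omega
        · exfalso
          have : R * (j + 1) ≤ R * k := Nat.mul_le_mul_left _ hh
          rw [mul_add, mul_one] at this
          omega
      · rw [zero_mul]

lemma aux_pow_expand (p e : ℕ) [Fact p.Prime] [CharP F p] (a : F[X]) :
    a ^ p ^ e = expand F (p ^ e) (a.map (iterateFrobenius F p e)) := by
  rw [← map_iterateFrobenius_expand, map_expand]

lemma aux_coeff_pow (p e : ℕ) [Fact p.Prime] [CharP F p] (u a : F[X]) (i j : ℕ)
    (hu : u.natDegree < p ^ e) (hi : i < p ^ e) :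
    (u * a ^ p ^ e).coeff (p ^ e * j + i) = u.coeff i * a.coeff j ^ p ^ e := by
  rw [aux_pow_expand, aux_coeff_expand _ _ _ _ _ (by omega) hu hi, coeff_map, iterateFrobenius_def]

lemma aux_h1 (p e : ℕ) [Fact p.Prime] [CharP F p] (he : 1 ≤ e) (a b n : F[X])
    (ha : a.natDegree ≤ p ^ e) (hb : b.natDegree ≤ p ^ e) (hn : n.natDegree < p ^ e)
    (h : n * (a ^ p ^ e + X * b ^ p ^ e) = a + X ^ (p ^ e * p ^ e) * b)
    (hW : derivative a * b - a * derivative b ≠ 0) :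
    ∃ G Δ : F[X], G ≠ 0 ∧ G.natDegree ≤ 2 ∧ Δ.natDegree ≤ 2 ∧ G * n = Δ ^ p ^ e := by
  have hR0 : ((p ^ e : ℕ) : F) = 0 := by
    rw [CharP.cast_eq_zero_iff F p]; exact dvd_pow_self p (by omega)
  have hRpos : 0 < p ^ e := by omega
  obtain ⟨z, hz⟩ : ∃ z : ℕ → F, ∀ j, z j = a.coeff j := ⟨_, fun _ => rfl⟩
  have hex : ∃ j, 1 ≤ j ∧ j < p ^ e ∧ (a.coeff j ≠ 0 ∨ b.coeff j ≠ 0) := by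
    by_contra hcon
    push Not at hcon
    have key : ∀ u : F[X], u.natDegree ≤ p ^ e → (∀ j, 1 ≤ j → j < p ^ e → u.coeff j = 0) →
        derivative u = 0 := by
      intro u hu hj
      ext m
      rw [coeff_derivative, coeff_zero]
      rcases lt_trichotomy (m + 1) (p ^ e) with h1 | h1 | h1
      · rw [hj _ (by omega) h1, zero_mul]
      · have : ((m : F) + 1) = ((m + 1 : ℕ) : F) := by push_cast; rfl
        rw [this, h1, hR0, mul_zero]
      · rw [coeff_eq_zero_of_natDegree_lt (by omega), zero_mul]
    apply hW
    rw [key a ha (fun j h1 h2 => (hcon j h1 h2).1), key b hb (fun j h1 h2 => (hcon j h1 h2).2)]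
    simp
  obtain ⟨j, hj1, hjR, hj⟩ := hex
  generalize hRR : p ^ e = R at *
  have rel : ∀ i, 1 ≤ i → i < R → n.coeff i * a.coeff j ^ R + n.coeff (i - 1) * b.coeff j ^ R = 0 := by
    intro i hi1 hi2
    have h1 := congrArg (fun P => coeff P (R * j + i)) h
    have hlt : R * j + i < R * R := by nlinarith
    have hge : R < R * j + i := by nlinarith
    simp only [coeff_add, mul_add] at h1
    rw [coeff_eq_zero_of_natDegree_lt (show a.natDegree < R * j + i by omega),
      coeff_X_pow_mul', if_neg (by omega)] at h1
    have e1 : (n * (X * b ^ R)).coeff (R * j + i) = n.coeff (i - 1) * b.coeff j ^ R := by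
      rw [show n * (X * b ^ R) = X * (n * b ^ R) by ring,
        show R * j + i = (R * j + (i - 1)) + 1 by omega, coeff_X_mul]
      subst hRR
      exact aux_coeff_pow p e n b (i - 1) j hn (by omega)
    have e2 : (n * a ^ R).coeff (R * j + i) = n.coeff i * a.coeff j ^ R := by
      subst hRR
      exact aux_coeff_pow p e n a i j hn (by omega)
    rw [e1, e2] at h1
    simpa using h1
  obtain ⟨z0, hz0⟩ := aux_root_elt p e (a.coeff j ^ R * n.coeff 0)
  obtain ⟨z1, hz1⟩ := aux_root_elt p e (b.coeff j ^ R * n.coeff (R - 1))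
  have hlin : ∀ x y : F, (C x + C y * X : F[X]).natDegree ≤ 2 := by
    intro x y
    compute_degree
    omega
  refine ⟨C (a.coeff j ^ R) + C (b.coeff j ^ R) * X, C z0 + C z1 * X, ?_, hlin _ _, hlin _ _, ?_⟩
  · intro h0
    have c0 := congrArg (fun P => coeff P 0) h0
    have c1 := congrArg (fun P => coeff P 1) h0
    simp only [coeff_add, coeff_C_mul, coeff_C_zero, coeff_X_zero, coeff_X_one, coeff_C_succ,
      coeff_zero, mul_zero, add_zero, mul_one, zero_add] at c0 c1
    rcases hj with hj | hj
    · exact pow_ne_zero _ hj c0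
    · exact pow_ne_zero _ hj c1
  · have hpw : (C z0 + C z1 * X : F[X]) ^ R = C (a.coeff j ^ R * n.coeff 0) +
        C (b.coeff j ^ R * n.coeff (R - 1)) * X ^ R := by
      rw [← hRR, add_pow_char_pow, mul_pow, ← C_pow, ← C_pow, hz0, hz1, hRR]
    rw [hpw, add_mul, mul_assoc]
    ext i
    rw [coeff_add, coeff_add, coeff_C_mul, coeff_C_mul, coeff_C_mul, coeff_C, coeff_X_pow]
    rcases Nat.eq_zero_or_pos i with rfl | hi
    · simp [hRpos.ne]
    · obtain ⟨s, rfl⟩ : ∃ s, i = s + 1 := ⟨i - 1, by omega⟩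
      rw [coeff_X_mul, if_neg (by omega)]
      rcases lt_trichotomy (s + 1) R with h1 | h1 | h1
      · rw [if_neg (by omega)]
        have := rel (s+1) (by omega) h1
        simp only [Nat.add_sub_cancel] at this
        linear_combination this
      · rw [if_pos h1, coeff_eq_zero_of_natDegree_lt (show n.natDegree < s + 1 by omega), show R - 1 = s by omega]
        ring
      · rw [if_neg (by omega), coeff_eq_zero_of_natDegree_lt (show n.natDegree < s + 1 by omega),
          coeff_eq_zero_of_natDegree_lt (show n.natDegree < s by omega)]
        ring

lemma aux_h2 (p e : ℕ) [Fact p.Prime] [CharP F p] (he : 1 ≤ e) (hR3 : 3 ≤ p ^ e) (a b n : F[X])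
    (ha : a.natDegree < p ^ e) (hb : b.natDegree < p ^ e) (hn : n.natDegree + 2 ≤ 2 * p ^ e)
    (h : n * (a ^ p ^ e + X * b ^ p ^ e) = a + X ^ (p ^ e * p ^ e) * b)
    (hW : derivative a * b - a * derivative b ≠ 0) :
    ∃ G Δ : F[X], G ≠ 0 ∧ G.natDegree ≤ 2 ∧ Δ.natDegree ≤ 2 ∧ G * n = Δ ^ p ^ e := by
  have hcp := fun u x i j => aux_coeff_pow p e (F := F) u x i j
  have hfr : ∀ x y : F[X], (x - y) ^ p ^ e = x ^ p ^ e - y ^ p ^ e := fun x y => sub_pow_char_pow ..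
  have hroot : ∀ c : F, ∃ z, z ^ p ^ e = c := fun c => aux_root_elt p e c
  have hinj : ∀ x y : F, x ^ p ^ e = y ^ p ^ e → x = y := by
    intro x y hxy
    exact iterateFrobenius_inj F p e (by simpa [iterateFrobenius_def] using hxy)
  generalize hRR : p ^ e = R at *
  have hmon : (X ^ R : F[X]).Monic := monic_X_pow R
  obtain ⟨lo, hi, hlo, hhi, hnd⟩ : ∃ lo hi : F[X], lo.natDegree < R ∧ hi.natDegree + 2 ≤ R ∧
      n = lo + X ^ R * hi := by
    refine ⟨n %ₘ X ^ R, n /ₘ X ^ R, ?_, ?_, (modByMonic_add_div n _).symm⟩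
    · have := natDegree_modByMonic_lt n hmon (by
        intro h1
        have := congrArg natDegree h1
        simp at this; omega)
      simpa using this
    · rw [natDegree_divByMonic n hmon, natDegree_X_pow]
      omega
  set c := lo.coeff (R - 1) with hc
  set lo' := X * lo - C c * X ^ R with hlo'
  have hlo'd : lo'.natDegree < R := by
    have : lo'.natDegree ≤ R - 1 := by
      rw [natDegree_le_iff_coeff_eq_zero]
      intro N hN
      obtain ⟨s, rfl⟩ : ∃ s, N = s + 1 := ⟨N - 1, by omega⟩
      rw [hlo', coeff_sub, coeff_X_mul, coeff_C_mul, coeff_X_pow]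
      split_ifs with h1
      · rw [hc, show R - 1 = s by omega]; ring
      · rw [coeff_eq_zero_of_natDegree_lt (by omega)]; ring
    omega
  have hXhi : (X * hi).natDegree < R := by
    have := natDegree_mul_le (p := (X : F[X])) (q := hi)
    rw [natDegree_X] at this
    omega
  have E : ∀ j, j + 1 < R → (C (a.coeff (j+1) ^ R) + X * C (b.coeff (j+1) ^ R)) * lo +
      (C (a.coeff j ^ R) + X * C (b.coeff j ^ R)) * hi =
      C c * (C (b.coeff (j+1) ^ R) * X ^ R - C (b.coeff j ^ R)) := by
    intro j hj
    have key : C (a.coeff (j+1) ^ R) * lo + C (b.coeff (j+1) ^ R) * lo' + C (a.coeff j ^ R) * hi +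
        C (b.coeff j ^ R) * (X * hi) + C (b.coeff j ^ R) * C c = 0 := by
      ext i
      simp only [coeff_add, coeff_C_mul, coeff_zero]
      by_cases hiR : i < R
      · have h1 := congrArg (fun P => coeff P (R * j + i + R)) h
        have hlt : R * j + i + R < R * R := by nlinarith
        simp only [coeff_add] at h1
        rw [coeff_eq_zero_of_natDegree_lt (show a.natDegree < R * j + i + R by omega),
          coeff_X_pow_mul', if_neg (by omega)] at h1
        have h2 : n * (a ^ R + X * b ^ R) = lo * a ^ R + lo' * b ^ R +
            (hi * a ^ R + (X * hi) * b ^ R + C c * b ^ R) * X ^ R := by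
          rw [hnd, hlo']; ring
        rw [h2] at h1
        simp only [coeff_add, coeff_mul_X_pow] at h1
        have hidx : R * j + i + R = R * (j + 1) + i := by ring
        rw [hcp hi a i j (by omega) hiR, hcp (X * hi) b i j hXhi hiR,
          hcp (C c) b i j (by simp; omega) hiR, hidx, hcp lo a i (j+1) hlo hiR,
          hcp lo' b i (j+1) hlo'd hiR] at h1
        linear_combination h1
      · have hx0 : (X * hi).coeff i = 0 := coeff_eq_zero_of_natDegree_lt (by omega)
        rw [coeff_eq_zero_of_natDegree_lt (show lo.natDegree < i by omega),
          coeff_eq_zero_of_natDegree_lt (show lo'.natDegree < i by omega),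
          coeff_eq_zero_of_natDegree_lt (show hi.natDegree < i by omega),
          hx0,
          coeff_C_of_ne_zero (by omega)]
        ring
    rw [hlo'] at key
    linear_combination key
  obtain ⟨c', hc'⟩ := hroot c
  by_cases hex : ∃ j k, j + 1 < R ∧ k + 1 < R ∧
      (C (a.coeff (j+1) ^ R) + X * C (b.coeff (j+1) ^ R)) * (C (a.coeff k ^ R) + X * C (b.coeff k ^ R))
      - (C (a.coeff (k+1) ^ R) + X * C (b.coeff (k+1) ^ R)) * (C (a.coeff j ^ R) + X * C (b.coeff j ^ R)) ≠ 0
  · obtain ⟨j, k, hj, hk, hG⟩ := hex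
    refine ⟨_, C c' * ((C (a.coeff (j+1)) * X - C (a.coeff j)) * (C (b.coeff (k+1)) * X - C (b.coeff k)) -
      (C (a.coeff (k+1)) * X - C (a.coeff k)) * (C (b.coeff (j+1)) * X - C (b.coeff j))), hG, ?_, ?_, ?_⟩
    · generalize a.coeff (j+1) ^ R = x1
      generalize b.coeff (j+1) ^ R = x2
      generalize a.coeff (k+1) ^ R = x3
      generalize b.coeff (k+1) ^ R = x4
      generalize a.coeff j ^ R = x5
      generalize b.coeff j ^ R = x6
      generalize a.coeff k ^ R = x7
      generalize b.coeff k ^ R = x8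
      compute_degree
    · compute_degree
    · have ej := E j hj
      have ek := E k hk
      rw [mul_pow, hfr, mul_pow, mul_pow, hfr, hfr, hfr, hfr, mul_pow, mul_pow, mul_pow, mul_pow]
      rw [← C_pow (a := c') (n := R), hc']
      simp only [C_pow] at ej ek ⊢
      rw [hnd]
      linear_combination ((C (a.coeff k) ^ R + X * C (b.coeff k) ^ R) - X ^ R * (C (a.coeff (k+1)) ^ R + X * C (b.coeff (k+1)) ^ R)) * ej - ((C (a.coeff j) ^ R + X * C (b.coeff j) ^ R) - X ^ R * (C (a.coeff (j+1)) ^ R + X * C (b.coeff (j+1)) ^ R)) * ek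
  · exfalso
    push Not at hex
    have hz : ∀ j k, j + 1 ≤ R - 1 → k + 1 ≤ R - 1 →
        a.coeff (j+1) ^ R * a.coeff k ^ R = a.coeff (k+1) ^ R * a.coeff j ^ R ∧
        b.coeff (j+1) ^ R * b.coeff k ^ R = b.coeff (k+1) ^ R * b.coeff j ^ R ∧
        a.coeff (j+1) ^ R * b.coeff k ^ R + b.coeff (j+1) ^ R * a.coeff k ^ R =
          a.coeff (k+1) ^ R * b.coeff j ^ R + b.coeff (k+1) ^ R * a.coeff j ^ R := by
      intro j k hj hk
      have h0 := hex j k (by omega) (by omega)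
      generalize a.coeff (j+1) ^ R = x1 at *
      generalize b.coeff (j+1) ^ R = x2 at *
      generalize a.coeff (k+1) ^ R = x3 at *
      generalize b.coeff (k+1) ^ R = x4 at *
      generalize a.coeff j ^ R = x5 at *
      generalize b.coeff j ^ R = x6 at *
      generalize a.coeff k ^ R = x7 at *
      generalize b.coeff k ^ R = x8 at *
      have h1 : (C (x1 * x7 - x3 * x5) + C (x1 * x8 + x2 * x7 - x3 * x6 - x4 * x5) * X +
          C (x2 * x8 - x4 * x6) * X ^ 2 : F[X]) = 0 := by
        simp only [C_add, C_sub, C_mul]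
        linear_combination h0
      have c0 := congrArg (fun P => coeff P 0) h1
      have c1 := congrArg (fun P => coeff P 1) h1
      have c2 := congrArg (fun P => coeff P 2) h1
      simp only [coeff_add, coeff_C_mul, coeff_X_pow, coeff_X, coeff_C, coeff_zero] at c0 c1 c2
      norm_num at c0 c1 c2
      refine ⟨?_, ?_, ?_⟩
      · linear_combination c0
      · linear_combination c2
      · linear_combination c1
    obtain ⟨u, w, huw, hall⟩ := aux_seq (fun i => a.coeff i ^ R) (fun i => b.coeff i ^ R) (R - 1)
      (by omega) (fun j k hj hk => (hz j k hj hk).1) (fun j k hj hk => (hz j k hj hk).2.1)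
      (fun j k hj hk => (hz j k hj hk).2.2)
    obtain ⟨u', rfl⟩ := hroot u
    obtain ⟨w', rfl⟩ := hroot w
    have hab : C u' * a = C w' * b := by
      ext i
      rw [coeff_C_mul, coeff_C_mul]
      by_cases hi : i < R
      · apply hinj
        rw [mul_pow, mul_pow]
        exact hall i (by omega)
      · rw [coeff_eq_zero_of_natDegree_lt (by omega), coeff_eq_zero_of_natDegree_lt (by omega)]
        ring
    have hd := congrArg derivative hab
    simp only [derivative_C_mul] at hd
    apply hW
    rcases huw with hu | hw
    · have : C u' ≠ 0 := by rw [Ne, C_eq_zero]; rintro rfl; exact hu (zero_pow (by omega))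
      apply mul_left_cancel₀ this
      linear_combination b * hd - derivative b * hab
    · have : C w' ≠ 0 := by rw [Ne, C_eq_zero]; rintro rfl; exact hw (zero_pow (by omega))
      apply mul_left_cancel₀ this
      linear_combination a * hd - derivative a * hab

end helpers4

section helpers5
variable {F : Type} [Field F] [Fintype F] [DecidableEq F]

lemma aux_dvd_sub (p e j r : ℕ) (hp : 1 ≤ p) (h1 : r ∣ p ^ e - 1) (h2 : r ∣ p ^ j - 1) (h : e ≤ j) :
    r ∣ p ^ (j - e) - 1 := by
  have h3 : p ^ j - 1 = p ^ (j - e) * (p ^ e - 1) + (p ^ (j - e) - 1) := by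
    have a1 : 1 ≤ p ^ (j - e) := Nat.one_le_pow _ _ hp
    have a2 : 1 ≤ p ^ e := Nat.one_le_pow _ _ hp
    rw [Nat.mul_sub, ← pow_add, Nat.sub_add_cancel h, mul_one]
    have a3 : p ^ (j - e) ≤ p ^ j := Nat.pow_le_pow_right hp (by omega)
    omega
  rw [h3] at h2
  exact (Nat.dvd_add_right (h1.mul_left _)).mp h2

lemma aux_dvd_mod (p e n r : ℕ) (hp : 1 ≤ p) (he : 1 ≤ e) (h1 : r ∣ p ^ e - 1) (h2 : r ∣ p ^ n - 1)
    (hmin : ∀ i, 0 < i → r ∣ p ^ i - 1 → e ≤ i) : e ∣ n := by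
  induction n using Nat.strong_induction_on with
  | _ n ih =>
    rcases Nat.eq_zero_or_pos n with rfl | hn
    · exact dvd_zero _
    · have hen := hmin n hn h2
      have h3 := ih (n - e) (by omega) (aux_dvd_sub p e n r hp h1 h2 hen)
      have := (Nat.dvd_add_right (dvd_refl e)).mpr h3
      rwa [Nat.add_sub_cancel' hen] at this

lemma aux_assoc (f L : F[X]) (r t q : ℕ) (hr : 1 ≤ r) (hq : 1 ≤ q) (hdv : r * t ∣ q - 1) (hL : L ≠ 0)
    (h : f ^ r * L = L ^ q) : ∃ (c : F) (g : F[X]), f = C c * g ^ t := by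
  obtain ⟨w, hw⟩ := hdv
  have h1 : f ^ r = (L ^ (w * t)) ^ r := by
    apply mul_right_cancel₀ hL
    rw [h, ← pow_mul, ← pow_succ]
    congr 1
    have : r * t * w = w * t * r := by ring
    omega
  have d1 : f ∣ L ^ (w * t) := by
    rw [← IsIntegrallyClosed.pow_dvd_pow_iff (show r ≠ 0 by omega), h1]
  have d2 : L ^ (w * t) ∣ f := by
    rw [← IsIntegrallyClosed.pow_dvd_pow_iff (show r ≠ 0 by omega), h1]
  obtain ⟨u, hu⟩ := associated_of_dvd_dvd d2 d1
  obtain ⟨c, -, hc⟩ := Polynomial.isUnit_iff.mp u.isUnit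
  exact ⟨c, L ^ w, by rw [← hu, ← hc, ← pow_mul, mul_comm]⟩

lemma aux_const (p n i r t : ℕ) [Fact p.Prime] [CharP F p] (hcard : Fintype.card F = p ^ n)
    (hi : i ≤ n) (hr : 1 ≤ r) (hdv : r * t ∣ p ^ n - 1) (f a b L : F[X]) (hL0 : L ≠ 0)
    (ha : a.natDegree = 0) (hb : b.natDegree = 0)
    (hL : L = a ^ p ^ i + X * b ^ p ^ i)
    (hE : f ^ r * L = (a + X ^ p ^ (n - i) * b) ^ p ^ i) :
    ∃ (c : F) (g : F[X]), f = C c * g ^ t := by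
  apply aux_assoc f L r t (p ^ n) hr (Nat.one_le_pow _ _ (Fact.out : p.Prime).pos) hdv hL0
  rw [hE, hL]
  rw [eq_C_of_natDegree_eq_zero ha, eq_C_of_natDegree_eq_zero hb]
  rw [add_pow_char_pow, add_pow_char_pow, mul_pow, mul_pow, ← pow_mul X, ← pow_add,
    Nat.sub_add_cancel hi]
  simp only [← C_pow]
  rw [← hcard, FiniteField.pow_card, FiniteField.pow_card]

lemma aux_arith (R r t α β η l : ℕ) (hr : 2 ≤ r) (ht : 2 ≤ t) (hR : R = r * t + 1)
    (htR : t * t + 1 ≤ R) (h1 : R * α ≤ l) (h2 : R * β + 1 ≤ l) (h3 : l = R * α ∨ l = R * β + 1)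
    (hl : l + r * η = R * R + β)
    (hw : (r - 1) * η + 1 ≤ α + β)
    (hd : r * (t * (R * R + β) + η) + 1 ≤ R * R * R) :
    (α ≤ R + 1 ∧ β ≤ R + 1) ∧ (η = 0 ∨ (α ≤ R ∧ β ≤ R ∧ η ≤ t) ∨ (α < R ∧ β < R ∧ η ≤ 2 * t)) := by
  have hb : t * β + η ≤ t * (R + 1) := by
    have : r * (t * β + η) ≤ r * (t * (R + 1)) := by
      have e1 : r * (t * (R * R + β) + η) = (r * t) * (R * R) + r * (t * β + η) := by ring
      have e2 : r * (t * (R + 1)) = (r * t) * (R + 1) := by ring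
      rw [e1] at hd
      rw [e2]
      obtain ⟨s, rfl⟩ : ∃ s, R = s + 1 := ⟨R - 1, by omega⟩
      have : r * t = s := by omega
      rw [this] at hd ⊢
      nlinarith
    exact Nat.le_of_mul_le_mul_left this (by omega)
  have hrt : r * t = R - 1 := by omega
  have htlt : t < R := by nlinarith
  have ha : t * α + η ≤ t * (R + 1) := by
    have e1 : t * (R * α) + t * (r * η) ≤ t * (R * R) + t * β := by nlinarith
    have e2 : R * (t * α + η) ≤ R * (t * (R + 1)) + t := by
      have : R * η = t * (r * η) + η := by rw [hR]; ring
      nlinarith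
    by_contra hcon
    push Not at hcon
    have : R * (t * (R + 1) + 1) ≤ R * (t * α + η) := Nat.mul_le_mul_left _ hcon
    nlinarith
  have hα : α ≤ R + 1 := by
    by_contra hcon
    push Not at hcon
    nlinarith
  have hβ : β ≤ R + 1 := by
    by_contra hcon
    push Not at hcon
    nlinarith
  refine ⟨⟨hα, hβ⟩, ?_⟩
  by_cases c1 : α = R + 1 ∨ β = R + 1
  · left
    rcases c1 with c | c
    · rw [c] at ha; omega
    · rw [c] at hb; omega
  by_cases c2 : α = R ∨ β = R
  · right; left
    refine ⟨by omega, by omega, ?_⟩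
    rcases c2 with c | c
    · rw [c] at ha; nlinarith
    · rw [c] at hb; nlinarith
  right; right
  refine ⟨by omega, by omega, ?_⟩
  by_cases c3 : α + 1 = R ∨ β + 1 = R
  · rcases c3 with c | c
    · rw [← c] at ha; nlinarith
    · rw [← c] at hb; nlinarith
  exfalso
  have hα2 : α + 2 ≤ R := by omega
  have hβ2 : β + 2 ≤ R := by omega
  obtain ⟨s, rfl⟩ : ∃ s, r = s + 1 := ⟨r - 1, by omega⟩
  simp only [Nat.add_sub_cancel] at hw
  rcases h3 with h3 | h3
  · have e0 : R * (α + 2) ≤ R * R := Nat.mul_le_mul_left _ hα2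
    rw [mul_add] at e0
    clear hd hb ha
    have e1 : 2 * R + β ≤ (s + 1) * η := by omega
    have e2 : (s + 1) * η = s * η + η := by ring
    have e3 : R + 3 ≤ η := by omega
    obtain ⟨δ, hδ⟩ : ∃ δ, (s + 1) * η = 2 * R + β + δ := ⟨_, (Nat.add_sub_cancel' e1).symm⟩
    have e4 : R + 3 + δ ≤ η := by omega
    have e5 : (s + 1) * (R + 3 + δ) ≤ (s + 1) * η := Nat.mul_le_mul_left _ e4
    have e6 : s = 1 := by
      by_contra hs
      have : 3 * (R + 3 + δ) ≤ (s + 1) * (R + 3 + δ) := Nat.mul_le_mul_right _ (by omega)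
      omega
    subst e6
    have : t ≤ 2 := by
      by_contra h9
      have : 3 * t ≤ t * t := Nat.mul_le_mul_right _ (by omega)
      omega
    omega
  · have e1 : η = t * (R + 1 - β) := by
      have : (s + 1) * η = (s + 1) * (t * (R + 1 - β)) := by
        obtain ⟨y, hy⟩ : ∃ y, R + 1 = β + y := ⟨R + 1 - β, by omega⟩
        have hy2 : R + 1 - β = y := by omega
        rw [hy2]
        obtain ⟨R', rfl⟩ : ∃ R', R = R' + 1 := ⟨R - 1, by omega⟩
        have : (s + 1) * t = R' := by omega
        rw [← mul_assoc, this]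
        have z1 : (R' + 1) * β + R' * y = R' * (β + y) + β := by ring
        have z2 : (R' + 1) * (R' + 1) = R' * (R' + 1 + 1) + 1 := by ring
        rw [← hy] at z1
        omega
      exact Nat.eq_of_mul_eq_mul_left (by omega) this
    have e2 : 3 * t ≤ η := by
      rw [e1, mul_comm 3]; exact Nat.mul_le_mul_left _ (by omega)
    have e3 : s * (3 * t) ≤ s * η := Nat.mul_le_mul_left _ e2
    have e4 : R + 2 ≤ 3 * t := by
      have : s * (3 * t) + 3 * t = 3 * ((s + 1) * t) := by ring
      omega
    have : t * t + 3 ≤ 3 * t := by omega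
    have : t ≤ 2 := by
      by_contra h9
      have : 3 * t ≤ t * t := Nat.mul_le_mul_right _ (by omega)
      omega
    obtain rfl : t = 2 := by omega
    omega

lemma aux_tbound (R t : ℕ) (hR : 5 ≤ R) (ht : 2 ≤ t) (htd : t ∣ R - 1) (x : ℝ) (hx : 0 ≤ x)
    (hx2 : x * x = (R:ℝ) * R * R) (hb : (t:ℝ) * (R * R) < (x + 1) * R) : t * t + 1 ≤ R := by
  have hR' : (5:ℝ) ≤ R := by exact_mod_cast hR
  have ht' : (2:ℝ) ≤ t := by exact_mod_cast ht
  have h1 : (t:ℝ) * R < x + 1 := by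
    by_contra hcon
    push Not at hcon
    nlinarith
  have h2 : ((t:ℝ) * R - 1) * (t * R - 1) < R * R * R := by
    rw [← hx2]
    nlinarith
  by_contra hcon
  push Not at hcon
  have hne : t * t ≠ R := by
    intro h
    have : t ∣ R - (R - 1) := Nat.dvd_sub (h ▸ dvd_mul_right t t) htd
    rw [show R - (R - 1) = 1 by omega] at this
    have := Nat.le_of_dvd one_pos this
    omega
  obtain ⟨δ, hδ⟩ : ∃ δ, t * t = R + 1 + δ := ⟨t * t - (R + 1), by omega⟩
  have hδ' : (t:ℝ) * t = R + 1 + δ := by exact_mod_cast hδ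
  have hδ0 : (0:ℝ) ≤ δ := Nat.cast_nonneg _
  have h3 : (R:ℝ) * (1 + δ) < 2 * t := by
    by_contra hc
    push Not at hc
    nlinarith
  have h4 : ((R:ℝ) * (1 + δ)) * (R * (1 + δ)) < (2 * t) * (2 * t) := by
    apply mul_self_lt_mul_self (by positivity) h3
  nlinarith [mul_nonneg hδ0 hδ0, mul_nonneg (mul_nonneg hδ0 hδ0) (by linarith : (0:ℝ) ≤ R), mul_nonneg hδ0 (by linarith : (0:ℝ) ≤ R - 5)]

lemma aux_Wdvd (p s r : ℕ) [Fact p.Prime] [CharP F p] (hs : 1 ≤ s) (hr : 1 ≤ r) (a b L N : F[X])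
    (hD : a + X ^ p ^ s * b = L * N ^ r) : N ^ (r - 1) ∣ derivative a * b - a * derivative b := by
  obtain ⟨k, rfl⟩ : ∃ k, r = k + 1 := ⟨r - 1, by omega⟩
  simp only [Nat.add_sub_cancel]
  have h1 : derivative (a + X ^ p ^ s * b) = derivative a + X ^ p ^ s * derivative b := by
    rw [derivative_add, derivative_mul, aux_der_pow p X s hs]; ring
  have h2 : N ^ k ∣ derivative (L * N ^ (k + 1)) := by
    rw [derivative_mul, derivative_pow]
    apply dvd_add
    · exact Dvd.dvd.mul_left (pow_dvd_pow _ (by omega)) _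
    · simp only [Nat.add_sub_cancel]
      exact ⟨L * (C ((k + 1 : ℕ) : F) * derivative N), by push_cast; ring⟩
  have h3 : N ^ k ∣ L * N ^ (k + 1) := Dvd.dvd.mul_left (pow_dvd_pow _ (by omega)) _
  rw [← hD, h1] at h2
  rw [← hD] at h3
  have : derivative a * b - a * derivative b =
      (derivative a + X ^ p ^ s * derivative b) * b - (a + X ^ p ^ s * b) * derivative b := by ring
  rw [this]
  exact dvd_sub (h2.mul_right _) (h3.mul_right _)

lemma aux_degD (a b : F[X]) (s : ℕ) :
    (a + X ^ s * b).natDegree ≤ a.natDegree ∨ (a + X ^ s * b).natDegree ≤ s + b.natDegree := by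
  have h1 := natDegree_add_le a (X ^ s * b)
  have h2 := natDegree_mul_le (p := (X ^ s : F[X])) (q := b)
  rw [natDegree_X_pow] at h2
  rcases le_max_iff.mp h1 with h | h
  · left; exact h
  · right; omega

lemma aux_core3 (p n e r t : ℕ) [Fact p.Prime] [CharP F p] (hcard : Fintype.card F = p ^ n)
    (he : 1 ≤ e) (hn3 : n = 3 * e) (hr : 2 ≤ r) (ht : 2 ≤ t) (hrt : p ^ e = r * t + 1)
    (hmin : ∀ i, 0 < i → r ∣ p ^ i - 1 → e ≤ i) (f : F[X]) (hf : f ≠ 0)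
    (hl : 0 < (auxL f).natDegree)
    (hdeg : r * f.natDegree + 1 ≤ p ^ n)
    (hbound : (f.natDegree : ℝ) < (Real.sqrt ((p : ℝ) ^ n) + 1) * (p : ℝ) ^ e)
    (a b N : F[X]) (hL : auxL f = a ^ p ^ e + X * b ^ p ^ e)
    (hE : f ^ r * auxL f = (a + X ^ p ^ (n - e) * b) ^ p ^ e)
    (hfN : f = (a + X ^ p ^ (n - e) * b) ^ t * N) (hD : a + X ^ p ^ (n - e) * b = auxL f * N ^ r)
    (hb0 : b ≠ 0) (hfin : ∀ (c : F) (Δ : F[X]), N = C c * Δ ^ t → ∃ (c : F) (g : F[X]), f = C c * g ^ t)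
    (hdv : r * t ∣ p ^ n - 1) :
    ∃ (c : F) (g : F[X]), f = C c * g ^ t := by
  have hpp : p.Prime := Fact.out
  have hR5 : 5 ≤ p ^ e := by rw [hrt]; nlinarith
  have hL0 : auxL f ≠ 0 := (auxL_monic f).ne_zero
  by_cases hW : derivative a * b - a * derivative b = 0
  · obtain ⟨hda, hdb⟩ := aux_W_zero a b (aux_coprime p he (auxL_sep f) hL) hW
    have h1 := aux_step p n e (by omega) _ _ a b hL hE hda hdb
    obtain ⟨a2, b2, hL2, hE2⟩ := aux_iter p n (e + 1) r (2 * e) (by omega) (by omega) (by omega) hr (by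
      intro j hj1 hj2 hj3
      have := hmin (j - e) (by omega) (aux_dvd_sub p e j r hpp.pos ⟨t, by omega⟩ hj3 (by omega))
      omega) f hf hl h1
    have hb2 := aux_b_ne p (show 1 ≤ 2 * e by omega) (auxL_sep f) hl hL2
    have hRR : p ^ (2 * e) = p ^ e * p ^ e := by rw [two_mul, pow_add]
    obtain ⟨g1, g2, -⟩ := aux_degs (by rw [hRR]; nlinarith) hL2 hb2
    have hsq : Squarefree (auxL f) := Polynomial.Separable.squarefree (auxL_sep f)
    have hDv : auxL f ∣ a2 + X ^ p ^ (n - 2 * e) * b2 := by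
      rw [← hsq.dvd_pow_iff_dvd (pow_ne_zero (2 * e) hpp.ne_zero)]
      exact ⟨f ^ r, by rw [← hE2]; ring⟩
    have hne : a2 + X ^ p ^ (n - 2 * e) * b2 ≠ 0 := by
      intro h0
      rw [h0, zero_pow (pow_ne_zero _ hpp.ne_zero)] at hE2
      exact mul_ne_zero (pow_ne_zero _ hf) hL0 hE2
    have hle := natDegree_le_of_dvd hDv hne
    have hdd := aux_degD a2 b2 (p ^ (n - 2 * e))
    rw [show n - 2 * e = e by omega] at hdd hle
    rw [hRR] at g1 g2
    have hz : a2.natDegree = 0 ∧ b2.natDegree = 0 := by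
      generalize p ^ e = R at *
      rcases hdd with h | h
      · exfalso
        have : R * R * a2.natDegree ≤ a2.natDegree := by omega
        have : a2.natDegree = 0 := by
          by_contra h0
          have : 1 * a2.natDegree < R * R * a2.natDegree :=
            Nat.mul_lt_mul_of_pos_right (by nlinarith) (by omega)
          omega
        omega
      · have hb' : b2.natDegree = 0 := by
          by_contra h0
          have : 1 ≤ b2.natDegree := by omega
          have : R * R * b2.natDegree + 1 ≤ R + b2.natDegree := by omega
          have : 5 * R ≤ R * R := Nat.mul_le_mul_right _ hR5
          nlinarith
        refine ⟨?_, hb'⟩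
        by_contra h0
        have : 1 ≤ a2.natDegree := by omega
        nlinarith
    exact aux_const p n (2 * e) r t hcard (by omega) (by omega) hdv f a2 b2 _ hL0 hz.1 hz.2 hL2 hE2
  · have hRR : p ^ (n - e) = p ^ e * p ^ e := by rw [← pow_add]; congr 1; omega
    have hnn : N ^ r * (a ^ p ^ e + X * b ^ p ^ e) = a + X ^ (p ^ e * p ^ e) * b := by
      rw [← hRR, hD, hL]; ring
    have hWd := aux_Wdvd p (n - e) r (by omega) (by omega) a b _ N hD
    have hWn := natDegree_le_of_dvd hWd hW
    rw [natDegree_pow] at hWn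
    have hWm := aux_W_deg a b hW
    obtain ⟨g1, g2, g3⟩ := aux_degs (by omega) hL hb0
    have hN0 : N ≠ 0 := by rintro rfl; rw [mul_zero] at hfN; exact hf hfN
    have hDd := congrArg natDegree hD
    rw [natDegree_mul hL0 (pow_ne_zero _ hN0), natDegree_pow] at hDd
    have hD0 : a + X ^ p ^ (n - e) * b ≠ 0 := by
      rw [hD]; exact mul_ne_zero hL0 (pow_ne_zero _ hN0)
    have hfd := congrArg natDegree hfN
    rw [natDegree_mul (pow_ne_zero _ hD0) hN0, natDegree_pow] at hfd
    have hdd := aux_degD a b (p ^ (n - e))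
    rw [hRR] at *
    have hq : p ^ n = p ^ e * p ^ e * p ^ e := by rw [← pow_add, ← pow_add]; congr 1; omega
    have hx2 : Real.sqrt ((p : ℝ) ^ n) * Real.sqrt ((p : ℝ) ^ n) =
        ((p ^ e : ℕ) : ℝ) * ((p ^ e : ℕ) : ℝ) * ((p ^ e : ℕ) : ℝ) := by
      rw [Real.mul_self_sqrt (by positivity)]
      exact_mod_cast hq
    have hbound' : (f.natDegree : ℝ) < (Real.sqrt ((p : ℝ) ^ n) + 1) * ((p ^ e : ℕ) : ℝ) := by
      push_cast; exact hbound
    have hdD : (a + X ^ (p ^ e * p ^ e) * b).natDegree = p ^ e * p ^ e + b.natDegree := by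
      have hXb : (X ^ (p ^ e * p ^ e) * b).natDegree = p ^ e * p ^ e + b.natDegree := by
        rw [natDegree_mul (pow_ne_zero _ X_ne_zero) hb0, natDegree_X_pow]
      rw [natDegree_add_eq_right_of_natDegree_lt, hXb]
      rw [hXb]
      generalize p ^ e = R at *
      have hR0 : 1 * a.natDegree ≤ R * a.natDegree := Nat.mul_le_mul_right _ (by omega)
      rcases hdd with h | h
      · exfalso
        have h5 : R * a.natDegree ≤ a.natDegree := by omega
        have : a.natDegree = 0 := by
          by_contra h0
          have : 1 * a.natDegree < R * a.natDegree :=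
            Nat.mul_lt_mul_of_pos_right (by omega) (by omega)
          omega
        omega
      · by_contra hcon
        have h6 : R * (R * R + b.natDegree) ≤ R * a.natDegree := Nat.mul_le_mul_left _ (by omega)
        have h7 : R * R < R * (R * R) := by nlinarith
        have h8 : b.natDegree ≤ R * b.natDegree := Nat.le_mul_of_pos_left _ (by omega)
        rw [mul_add] at h6
        omega
    have htt : t * t + 1 ≤ p ^ e := by
      apply aux_tbound (p ^ e) t hR5 ht ⟨r, by rw [hrt, Nat.add_sub_cancel, mul_comm]⟩ _
        (Real.sqrt_nonneg _) hx2
      refine lt_of_le_of_lt ?_ hbound'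
      have : t * (p ^ e * p ^ e) ≤ f.natDegree := by
        rw [hfd, hdD]; nlinarith
      exact_mod_cast this
    rw [hdD] at hDd hfd
    rw [hfd, hq] at hdeg
    obtain ⟨-, hcase⟩ := aux_arith (p ^ e) r t a.natDegree b.natDegree N.natDegree _ hr ht hrt htt g1 g2 g3
      hDd.symm (by omega) hdeg
    rcases hcase with hc | ⟨c1, c2, c3⟩ | ⟨c1, c2, c3⟩
    · exact hfin (N.coeff 0) 1 (by rw [one_pow, mul_one]; exact eq_C_of_natDegree_eq_zero hc)
    · obtain ⟨G, Δ, hG, hGd, hΔ, hGN⟩ := aux_h1 p e he a b (N ^ r) c1 c2 (by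
        rw [natDegree_pow, hrt]
        have := Nat.mul_le_mul_left r c3
        omega) hnn hW
      rw [hrt] at hGN
      obtain ⟨c, hc⟩ := aux_final N G Δ r t hr hN0 hG hGd hΔ (by omega) hGN
      exact hfin c Δ hc
    · obtain ⟨G, Δ, hG, hGd, hΔ, hGN⟩ := aux_h2 p e he (by omega) a b (N ^ r) c1 c2 (by
        rw [natDegree_pow, hrt]
        have := Nat.mul_le_mul_left r c3
        have h9 : r * (2 * t) = 2 * (r * t) := by ring
        omega) hnn hW
      rw [hrt] at hGN
      obtain ⟨c, hc⟩ := aux_final N G Δ r t hr hN0 hG hGd hΔ c3 hGN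
      exact hfin c Δ hc

lemma aux_core (p n e r t : ℕ) [Fact p.Prime] [CharP F p] (hcard : Fintype.card F = p ^ n)
    (hn : 1 ≤ n) (he : 1 ≤ e) (hen : e ∣ n) (hr : 2 ≤ r) (ht : 2 ≤ t) (hrt : p ^ e = r * t + 1)
    (hmin : ∀ i, 0 < i → r ∣ p ^ i - 1 → e ≤ i) (f : F[X]) (hd : 0 < f.natDegree)
    (hval : ∀ a, f.eval a = 0 ∨ f.eval a ^ r = 1) (hroot : ∃ a, f.eval a = 0)
    (hdeg : r * f.natDegree + 1 ≤ p ^ n) (hq : p ^ n ≤ (r + 1) * f.natDegree)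
    (hbound : (f.natDegree : ℝ) < (Real.sqrt ((p : ℝ) ^ n) + 1) * (p : ℝ) ^ e) :
    ∃ (c : F) (g : F[X]), f = C c * g ^ t := by
  have hpp : p.Prime := Fact.out
  have hf : f ≠ 0 := by rintro rfl; simp at hd
  have hR5 : 5 ≤ p ^ e := by rw [hrt]; nlinarith
  have hL0 : auxL f ≠ 0 := (auxL_monic f).ne_zero
  have hl : 0 < (auxL f).natDegree := by
    rw [auxL_natDegree, Finset.card_pos]
    obtain ⟨x, hx⟩ := hroot
    exact ⟨x, by simp [hx]⟩
  obtain ⟨hs1, hs2⟩ := aux_struct f r hr hd hval (by rw [hcard]; exact hdeg) (by rw [hcard]; exact hq)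
  rw [hcard] at hs1
  have hen' : e ≤ n := Nat.le_of_dvd (by omega) hen
  obtain ⟨a, b, hL, hE⟩ := aux_iter p n 1 r e le_rfl he hen' hr (by
    intro j hj1 hj2 hj3
    have := hmin j (by omega) hj3
    omega) f hf hl (aux_base p n hn _ _ hs1 hs2)
  have hb0 := aux_b_ne p he (auxL_sep f) hl hL
  obtain ⟨N, hfN, hD⟩ := aux_decomp f _ _ r t (p ^ e) (by omega) hrt hf (auxL_sep f) hE
  have hfin : ∀ (c : F) (Δ : F[X]), N = C c * Δ ^ t → ∃ (c : F) (g : F[X]), f = C c * g ^ t := by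
    intro c Δ h
    refine ⟨c, (a + X ^ p ^ (n - e) * b) * Δ, ?_⟩
    rw [mul_pow]
    nth_rewrite 1 [hfN]
    nth_rewrite 1 [h]
    ring
  have hconst : N.natDegree = 0 → ∃ (c : F) (g : F[X]), f = C c * g ^ t := fun hc =>
    hfin (N.coeff 0) 1 (by rw [one_pow, mul_one]; exact eq_C_of_natDegree_eq_zero hc)
  obtain ⟨j, hj⟩ := hen
  have hdv : r * t ∣ p ^ n - 1 := by
    have : r * t = p ^ e - 1 := by omega
    rw [this, hj, pow_mul]
    simpa using Nat.sub_dvd_pow_sub_pow (p ^ e) 1 j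
  obtain ⟨g1, g2, g3⟩ := aux_degs (by omega) hL hb0
  have hN0 : N ≠ 0 := by rintro rfl; rw [mul_zero] at hfN; exact hf hfN
  have hDd := congrArg natDegree hD
  rw [natDegree_mul hL0 (pow_ne_zero _ hN0), natDegree_pow] at hDd
  have hdd := aux_degD a b (p ^ (n - e))
  have hNr : N.natDegree ≤ r * N.natDegree := Nat.le_mul_of_pos_left _ (by omega)
  have hA : ¬ (a + X ^ p ^ (n - e) * b).natDegree ≤ a.natDegree := by
    intro h
    have : a.natDegree = 0 := by
      by_contra h0
      have : 1 * a.natDegree < p ^ e * a.natDegree :=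
        Nat.mul_lt_mul_of_pos_right (by omega) (by omega)
      omega
    omega
  have hdd2 := hdd.resolve_left hA
  rcases Nat.lt_or_ge j 4 with hj4 | hj4
  · interval_cases j
    · omega
    · rw [show n - e = 0 by omega, pow_zero] at hdd2 hDd
      apply hconst
      have h8 : b.natDegree ≤ p ^ e * b.natDegree := Nat.le_mul_of_pos_left _ (by omega)
      omega
    · rw [show n - e = e by omega] at hdd2 hDd
      by_cases hcc : N.natDegree = 0
      · exact hconst hcc
      · have hz : a.natDegree = 0 ∧ b.natDegree = 0 := by
          generalize p ^ e = R at *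
          have hb' : b.natDegree = 0 := by
            by_contra h0
            obtain ⟨s, hs⟩ : ∃ s, b.natDegree = s + 1 := ⟨b.natDegree - 1, by omega⟩
            rw [hs] at g2 hdd2
            have : s ≤ R * s := Nat.le_mul_of_pos_left _ (by omega)
            rw [mul_add] at g2
            omega
          refine ⟨?_, hb'⟩
          by_contra h0
          have : R * 1 ≤ R * a.natDegree := Nat.mul_le_mul_left _ (by omega)
          omega
        exact aux_const p n e r t hcard hen' (by omega) hdv f a b _ hL0 hz.1 hz.2 hL hE
    · exact aux_core3 p n e r t hcard he (by omega) hr ht hrt hmin f hf hl hdeg hbound a b N hL hE hfN hD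
        hb0 hfin hdv
  · exfalso
    set x := Real.sqrt ((p : ℝ) ^ n) with hx
    have hx0 : 0 ≤ x := Real.sqrt_nonneg _
    have hx2 : x * x = (p : ℝ) ^ n := Real.mul_self_sqrt (by positivity)
    have hp1 : (1:ℝ) ≤ p := by exact_mod_cast hpp.one_le
    have hR' : (5:ℝ) ≤ (p:ℝ) ^ e := by exact_mod_cast hR5
    have hxR : ((p:ℝ) ^ e) ^ 2 ≤ x := by
      apply Real.le_sqrt_of_sq_le
      rw [← pow_mul, ← pow_mul]
      apply pow_le_pow_right₀ hp1
      rw [hj]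
      have := Nat.mul_le_mul_left e hj4
      omega
    have hq' : x * x ≤ ((r:ℝ) + 1) * f.natDegree := by rw [hx2]; exact_mod_cast hq
    have hr2 : 2 * ((r:ℝ) + 1) ≤ (p:ℝ) ^ e + 1 := by
      have : 2 * (r + 1) ≤ p ^ e + 1 := by
        have := Nat.mul_le_mul_left r ht
        omega
      exact_mod_cast this
    generalize (p:ℝ) ^ e = R at *
    have h1 : 2 * (x * x) ≤ (R + 1) * f.natDegree := by
      have : (2 * ((r:ℝ) + 1)) * f.natDegree ≤ (R + 1) * f.natDegree :=
        mul_le_mul_of_nonneg_right hr2 (Nat.cast_nonneg _)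
      linarith
    have h2 : (R + 1) * f.natDegree < (R + 1) * ((x + 1) * R) :=
      mul_lt_mul_of_pos_left hbound (by linarith)
    have h3 : R ^ 2 * x ≤ x * x := mul_le_mul_of_nonneg_right hxR hx0
    have h4 : (R ^ 2 - R) * R ^ 2 ≤ (R ^ 2 - R) * x := mul_le_mul_of_nonneg_left hxR (by nlinarith)
    have h5 : R ^ 2 + R ≤ (R ^ 2 - R) * R ^ 2 := by
      have : 1 * R ^ 2 ≤ R * R ^ 2 := by nlinarith
      have : (2:ℝ) ≤ R ^ 2 - R := by nlinarith
      nlinarith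
    nlinarith

end helpers5

section helpers6
variable {F : Type} [Field F] [Fintype F] [DecidableEq F]

lemma aux_fiber (h : F[X]) (hd : 0 < h.natDegree) (s : Finset F) (y : F) :
    (s.filter (fun x => h.eval x = y)).card ≤ h.natDegree := by
  have h0 : h - C y ≠ 0 := by
    intro h1
    rw [sub_eq_zero] at h1
    rw [h1] at hd; simp at hd
  have h1 : (h - C y).natDegree = h.natDegree := natDegree_sub_C
  rw [← h1]
  apply card_le_degree_of_subset_roots
  intro x hx
  rw [Finset.mem_val, Finset.mem_filter] at hx
  rw [mem_roots h0]
  simp [IsRoot, hx.2]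

lemma aux_fix (R : ℕ) (hR : 1 < R) (s : Finset F) (hs : ∀ x ∈ s, x ^ R = x) : s.card ≤ R := by
  have hd := FiniteField.X_pow_card_sub_X_natDegree_eq F hR
  calc s.card ≤ (X ^ R - X : F[X]).natDegree := by
        apply card_le_degree_of_subset_roots
        intro x hx
        rw [mem_roots (FiniteField.X_pow_card_sub_X_ne_zero F hR)]
        simp [IsRoot, hs x hx]
    _ = R := hd

lemma aux_finish (f g : F[X]) (r t R : ℕ) (hr : 1 ≤ r) (ht : 1 ≤ t) (hR : R = r * t + 1)
    (hfg : f = g ^ t) (hd : 0 < f.natDegree)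
    (hval : ∀ a, f.eval a = 0 ∨ f.eval a ^ r = 1)
    (hdeg : r * f.natDegree + 1 ≤ Fintype.card F) :
    g ∈ MVSPset (Finset.univ.filter (fun c : F => c ^ R = c)) := by
  have hrt1 : 1 ≤ r * t := Nat.mul_pos hr ht
  have hdf : f.natDegree = t * g.natDegree := by rw [hfg, natDegree_pow]
  have hg : 0 < g.natDegree := by
    rcases Nat.eq_zero_or_pos g.natDegree with h | h
    · rw [hdf, h] at hd; omega
    · exact h
  have hsub : valueSet g ⊆ Finset.univ.filter (fun c : F => c ^ R = c) := by
    intro y hy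
    obtain ⟨x, -, rfl⟩ := Finset.mem_image.mp hy
    rw [Finset.mem_filter]
    refine ⟨Finset.mem_univ _, ?_⟩
    have h1 := hval x
    rw [hfg, eval_pow] at h1
    rcases h1 with h1 | h1
    · have : g.eval x = 0 := by simpa using pow_eq_zero_iff (by omega) |>.mp h1
      simp only [this]
      exact zero_pow (by omega)
    · rw [hR, pow_succ, mul_comm r t, pow_mul, h1, one_mul]
  have h1 : (Finset.univ.filter (fun c : F => c ^ R = c)).card ≤ R :=
    aux_fix R (by omega) _ (by simp)
  have h2 : Fintype.card F ≤ g.natDegree * (valueSet g).card :=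
    Finset.card_le_mul_card_image (s := (Finset.univ : Finset F)) g.natDegree
      (fun y _ => aux_fiber g hg _ y)
  have h3 : (Fintype.card F - 1) / g.natDegree < (valueSet g).card := by
    rw [Nat.div_lt_iff_lt_mul hg, mul_comm]
    have : 0 < Fintype.card F := Fintype.card_pos
    omega
  have h4 : r * t ≤ (Fintype.card F - 1) / g.natDegree := by
    rw [Nat.le_div_iff_mul_le hg, mul_assoc, ← hdf]
    omega
  have h5 := Finset.card_le_card hsub
  have heq := Finset.eq_of_subset_of_card_le hsub (by omega)
  exact ⟨⟨hg, by omega⟩, heq⟩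

end helpers6

/-- if `U = 𝔽_{p^{mk}}` is a subfield, `e` minimal with `U^v ⊆ 𝔽_{p^e}` and
`t = v(p^e - 1)/(p^{mk} - 1)`, then every `F ∈ 𝒫(U^v, q)` not of the form `f^t` with
`f ∈ 𝒫(𝔽_{p^e}, q)` satisfies: `t > 1`, `U^v` is not a subfield, and
`deg F ≥ (√(p^n) + 1) · p^e`. -/
theorem stmt_4 (p n k v m e t : ℕ) (hp : p.Prime) (hn : 0 < n) (hk : k ∣ n)
    (hv : 1 < v) (hvd : v ∣ p ^ k - 1)
    (F : Type) [Field F] [Fintype F] [DecidableEq F]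
    (hcard : Fintype.card F = p ^ n)
    (U : Finset F) (hUdef : U = Finset.univ.filter (fun c : F => c ^ p ^ (m * k) = c))
    (hUcard : U.card = p ^ (m * k))
    (hUv : 2 < (U.image (fun u => u ^ v)).card)
    (he : 0 < e) (heU : ∀ s ∈ U.image (fun u => u ^ v), s ^ p ^ e = s)
    (hemin : ∀ e', 0 < e' → (∀ s ∈ U.image (fun u => u ^ v), s ^ p ^ e' = s) → e ≤ e')
    (ht : t * (p ^ (m * k) - 1) = v * (p ^ e - 1)) :
    ∀ f ∈ MVSPset (U.image (fun u => u ^ v)),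
      (¬ ∃ g ∈ MVSPset (Finset.univ.filter (fun c : F => c ^ p ^ e = c)), f = g ^ t) →
      1 < t ∧
      (¬ ∃ K : Subfield F, (↑(U.image (fun u => u ^ v)) : Set F) = (K : Set F)) ∧
      (Real.sqrt ((p : ℝ) ^ n) + 1) * (p : ℝ) ^ e ≤ (f.natDegree : ℝ) := by
  intro f hf hnot
  have : Fact p.Prime := ⟨hp⟩
  have hcharP : CharP F p := charP_of_card_eq_prime_pow hcard
  have hkpos : 0 < k := Nat.pos_of_dvd_of_pos hk hn
  have hmk : m * k ≠ 0 := by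
    intro h0
    rw [h0] at hUdef hUcard
    have : U = Finset.univ := by rw [hUdef]; ext x; simp
    rw [this, Finset.card_univ, hcard, pow_zero] at hUcard
    have := Nat.one_lt_pow hn.ne' hp.one_lt
    omega
  have hQ : 1 < p ^ (m * k) := Nat.one_lt_pow hmk hp.one_lt
  have hvQ : v ∣ p ^ (m * k) - 1 := by
    refine hvd.trans ?_
    rw [mul_comm m k, pow_mul]
    simpa using Nat.sub_dvd_pow_sub_pow (p ^ k) 1 m
  obtain ⟨r, hr⟩ := hvQ
  have hr1 : 1 ≤ r := by
    rcases Nat.eq_zero_or_pos r with h | h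
    · rw [h] at hr; omega
    · exact h
  have hmemU : ∀ u, u ∈ U ↔ u ^ p ^ (m * k) = u := by intro u; rw [hUdef]; simp
  set S := U.image (fun u => u ^ v) with hS
  have hSval : ∀ s ∈ S, s = 0 ∨ s ^ r = 1 := by
    intro s hs
    obtain ⟨u, hu, rfl⟩ := Finset.mem_image.mp hs
    by_cases hu0 : u = 0
    · left; simp [hu0]; omega
    · right
      rw [hmemU] at hu
      have h1 : u ^ (p ^ (m * k) - 1) = 1 := by
        apply mul_right_cancel₀ hu0
        rw [← pow_succ, Nat.sub_add_cancel hQ.le, hu, one_mul]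
      rw [← pow_mul, ← hr, h1]
  have hfixS : ∀ i, r ∣ i → ∀ s ∈ S, s ^ (i + 1) = s := by
    intro i ⟨w, hw⟩ s hs
    rcases hSval s hs with h | h
    · rw [h]; exact zero_pow (by omega)
    · rw [pow_succ, hw, pow_mul, h, one_pow, one_mul]
  have hS1 : S.card ≤ r + 1 := aux_fix (r + 1) (by omega) S (hfixS r dvd_rfl)
  have h0U : (0 : F) ∈ U := by rw [hmemU]; exact zero_pow (by omega)
  have h0S : (0 : F) ∈ S := Finset.mem_image.mpr ⟨0, h0U, zero_pow (by omega)⟩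
  have h1S : (1 : F) ∈ S := Finset.mem_image.mpr ⟨1, by rw [hmemU]; simp, one_pow v⟩
  have hS2 : r + 1 ≤ S.card := by
    have h1 : (U.erase 0).card ≤ v * ((U.erase 0).image (fun u => u ^ v)).card := by
      apply Finset.card_le_mul_card_image
      intro y _
      have := aux_fiber (X ^ v : F[X]) (by rw [natDegree_X_pow]; omega) (U.erase 0) y
      simpa using this
    have h2 : (U.erase 0).image (fun u => u ^ v) ⊆ S.erase 0 := by
      intro y hy
      obtain ⟨u, hu, rfl⟩ := Finset.mem_image.mp hy
      rw [Finset.mem_erase] at hu ⊢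
      exact ⟨pow_ne_zero _ hu.1, Finset.mem_image.mpr ⟨u, hu.2, rfl⟩⟩
    have h3 := Finset.card_le_card h2
    rw [Finset.card_erase_of_mem h0S] at h3
    rw [Finset.card_erase_of_mem h0U, hUcard, hr] at h1
    have h4 := Nat.le_of_mul_le_mul_left h1 (by omega)
    have : 0 < S.card := Finset.card_pos.mpr ⟨0, h0S⟩
    omega
  have hScard : S.card = r + 1 := le_antisymm hS1 hS2
  have hr2 : 2 ≤ r := by omega
  have hpe : 1 < p ^ e := Nat.one_lt_pow he.ne' hp.one_lt
  have hrt : p ^ e = r * t + 1 := by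
    rw [hr] at ht
    have : v * (r * t) = v * (p ^ e - 1) := by rw [← ht]; ring
    have := Nat.eq_of_mul_eq_mul_left (by omega) this
    omega
  have hmin : ∀ i, 0 < i → r ∣ p ^ i - 1 → e ≤ i := by
    intro i hi hri
    apply hemin i hi
    intro s hs
    have := hfixS _ hri s hs
    rwa [Nat.sub_add_cancel (Nat.one_le_pow _ _ hp.pos)] at this
  have hrn : r ∣ p ^ n - 1 := by
    have hg : 0 < Nat.gcd r (p ^ n - 1) := Nat.gcd_pos_of_pos_left _ (by omega)
    have h1 : S.card ≤ Nat.gcd r (p ^ n - 1) + 1 := by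
      apply aux_fix _ (by omega)
      intro s hs
      by_cases hs0 : s = 0
      · rw [hs0]; exact zero_pow (by omega)
      · have h1 := (hSval s hs).resolve_left hs0
        have h2 : s ^ (p ^ n - 1) = 1 := by
          rw [← hcard]; exact FiniteField.pow_card_sub_one_eq_one s hs0
        rw [pow_succ, pow_gcd_eq_one.mpr ⟨h1, h2⟩, one_mul]
    have h2 : Nat.gcd r (p ^ n - 1) ≤ r := Nat.gcd_le_left _ (by omega)
    have h3 : Nat.gcd r (p ^ n - 1) = r := by omega
    rw [← h3]
    exact Nat.gcd_dvd_right _ _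
  have hen : e ∣ n := aux_dvd_mod p e n r hp.pos he ⟨t, by omega⟩ hrn hmin
  obtain ⟨⟨hd, hfc⟩, hfS⟩ := hf
  rw [hfS, hScard, hcard] at hfc
  have hfr : (p ^ n - 1) / f.natDegree = r := by omega
  have hpn : 1 ≤ p ^ n := Nat.one_le_pow _ _ hp.pos
  have hdeg : r * f.natDegree + 1 ≤ p ^ n := by
    have := Nat.div_mul_le_self (p ^ n - 1) f.natDegree
    rw [hfr] at this
    omega
  have hqd : p ^ n ≤ (r + 1) * f.natDegree := by
    have := Nat.lt_succ_self ((p ^ n - 1) / f.natDegree)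
    rw [Nat.div_lt_iff_lt_mul hd, hfr] at this
    simp only [Nat.succ_eq_add_one] at this
    omega
  have hmemS : ∀ a, f.eval a ∈ S := by
    intro a
    rw [← hfS]
    exact Finset.mem_image.mpr ⟨a, Finset.mem_univ _, rfl⟩
  have hsurj : ∀ s ∈ S, ∃ a, f.eval a = s := by
    intro s hs
    rw [← hfS] at hs
    obtain ⟨a, -, ha⟩ := Finset.mem_image.mp hs
    exact ⟨a, ha⟩
  have hval : ∀ a, f.eval a = 0 ∨ f.eval a ^ r = 1 := fun a => hSval _ (hmemS a)
  have ht1 : 1 ≤ t := by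
    rcases Nat.eq_zero_or_pos t with h | h
    · rw [h] at hrt; omega
    · exact h
  have hno : ∀ g : F[X], f ≠ g ^ t := by
    intro g hfg
    exact hnot ⟨g, aux_finish f g r t (p ^ e) hr1 ht1 hrt hfg hd hval (by rw [hcard]; exact hdeg), hfg⟩
  have ht2 : 1 < t := by
    rcases Nat.lt_or_ge 1 t with h | h
    · exact h
    · exfalso
      have : t = 1 := by omega
      exact hno f (by rw [this, pow_one])
  refine ⟨ht2, ?_, ?_⟩
  · rintro ⟨K, hK⟩
    have hc : Nat.card K = r + 1 := by
      rw [← hScard, ← Set.ncard_coe_finset, hK]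
      exact Nat.card_coe_set_eq _
    have hfk : Fintype K := Fintype.ofFinite K
    have hck : CharP K p := (RingHom.charP_iff (algebraMap K F) (algebraMap K F).injective p).mpr hcharP
    obtain ⟨j, -, hj⟩ := FiniteField.card K p
    rw [Nat.card_eq_fintype_card, hj] at hc
    have hej := hmin j j.pos ⟨1, by omega⟩
    have h1 : p ^ e ≤ p ^ (j : ℕ) := Nat.pow_le_pow_right hp.pos hej
    have : r * 2 ≤ r * t := Nat.mul_le_mul_left _ ht2
    omega
  · by_contra hcon
    push Not at hcon
    obtain ⟨a0, ha0⟩ := hsurj 0 h0S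
    obtain ⟨a1, ha1⟩ := hsurj 1 h1S
    obtain ⟨c, g, hcg⟩ := aux_core p n e r t hcard hn he hen hr2 ht2 hrt hmin f hd hval ⟨a0, ha0⟩
      hdeg hqd hcon
    apply hno (C ((g.eval a1)⁻¹) * g)
    rw [hcg, eval_mul, eval_C, eval_pow] at ha1
    have hc : c = ((g.eval a1)⁻¹) ^ t := by
      rw [inv_pow]
      exact eq_inv_of_mul_eq_one_left ha1
    rw [mul_pow, ← C_pow, ← hc]
    exact hcg
end
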